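/- arXiv:1612.00597 — 6 statements merged into one kernel-verified Lean document; each statement's English description precedes it below -/
import Mathlib

section
/- For every r with 1/√2 < r < 1, the quantity m(r) = sup { M_f(r)/‖f‖_∞ : f analytic and bounded in 𝔻, f not identically 0 } satisfies m(r) < 1/√(1 − r²); that is, there exists a constant c < 1/√(1 − r²) such that Σ_{n=0}^∞ |a_n| r^n ≤ c ‖f‖_∞ for every bounded analytic f(z) = Σ_{n=0}^∞ a_n z^n in 𝔻. -/
section Orbits

open Matrix

/-- In finite dimension, an invariance of a functional along forward iterates of an injective
operator propagates to backward iterates. -/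
theorem apply_const_of_forward_iterates {F : Type*} [AddCommGroup F] [Module ℂ F]
    [FiniteDimensional ℂ F] (Λ : F →ₗ[ℂ] F) (hΛ : Function.Injective Λ) (φ : F →ₗ[ℂ] ℂ)
    (x : ℕ → F) (y : F) (hx : ∀ m, Λ (x (m + 1)) = x m) (hx0 : x 0 = y)
    (h : ∀ n : ℕ, φ ((Λ ^ n) y) = φ y) (m : ℕ) : φ (x m) = φ y := by
  let K : Submodule ℂ F := ⨅ n : ℕ, LinearMap.ker (φ ∘ₗ (Λ ^ n))
  have hK : ∀ z, z ∈ K ↔ ∀ n : ℕ, φ ((Λ ^ n) z) = 0 := fun z => by simp [K]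
  have hmap : K.map Λ ≤ K := by
    rintro _ ⟨z, hz, rfl⟩
    rw [hK]
    intro n
    have := (hK z).1 hz (n + 1)
    rwa [pow_succ] at this
  have heq : K.map Λ = K :=
    Submodule.eq_of_le_of_finrank_eq hmap (Submodule.equivMapOfInjective Λ hΛ K).finrank_eq.symm
  have key : ∀ m, Λ (x m) - x m ∈ K := by
    intro m
    induction m with
    | zero =>
      rw [hK, hx0]
      intro n
      have h1 := h (n + 1)
      rw [pow_succ] at h1
      rw [map_sub, map_sub, h n, ← h1]
      simp
    | succ m ih =>
      rw [← heq] at ih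
      obtain ⟨z, hz, hz'⟩ := ih
      have : z = Λ (x (m + 1)) - x (m + 1) := by
        apply hΛ
        rw [hz', map_sub, hx]
      rwa [← this]
  induction m with
  | zero => rw [hx0]
  | succ m ih =>
    have := (hK _).1 (key (m + 1)) 0
    rw [hx] at this
    simp only [pow_zero, Module.End.one_apply, map_sub, sub_eq_zero] at this
    rw [← this, ih]

/-- A complex matrix with bounded forward orbits on a spanning set has determinant of modulus at
most one. -/
theorem norm_det_le_one_of_bounded_orbits {d : ℕ} (L : Matrix (Fin d) (Fin d) ℂ)
    (h : Submodule.span ℂ {x : Fin d → ℂ | ∃ C : ℝ, ∀ (m : ℕ) (i : Fin d),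
      ‖((L ^ m) *ᵥ x) i‖ ≤ C} = ⊤) : ‖L.det‖ ≤ 1 := by
  have hall : ∀ x : Fin d → ℂ, ∃ C : ℝ, ∀ (m : ℕ) (i : Fin d), ‖((L ^ m) *ᵥ x) i‖ ≤ C := by
    intro x
    have hx : x ∈ Submodule.span ℂ {x : Fin d → ℂ | ∃ C : ℝ, ∀ (m : ℕ) (i : Fin d),
      ‖((L ^ m) *ᵥ x) i‖ ≤ C} := h ▸ Submodule.mem_top
    induction hx using Submodule.span_induction with
    | mem x hx => exact hx
    | zero => exact ⟨0, by simp⟩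
    | add x y _ _ hx hy =>
      obtain ⟨C, hC⟩ := hx
      obtain ⟨D, hD⟩ := hy
      refine ⟨C + D, fun m i => ?_⟩
      rw [mulVec_add]
      exact (norm_add_le _ _).trans (add_le_add (hC m i) (hD m i))
    | smul c x _ hx =>
      obtain ⟨C, hC⟩ := hx
      refine ⟨‖c‖ * C, fun m i => ?_⟩
      rw [mulVec_smul, Pi.smul_apply, norm_smul]
      exact mul_le_mul_of_nonneg_left (hC m i) (norm_nonneg c)
  choose C hC using hall
  let B : ℝ := ∑ j, |C (Pi.single j 1)|
  have hB : ∀ (m : ℕ) (i j : Fin d), ‖(L ^ m) i j‖ ≤ B := by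
    intro m i j
    have h1 := hC (Pi.single j 1) m i
    rw [mulVec_single_one] at h1
    exact (h1.trans (le_abs_self _)).trans
      (Finset.single_le_sum (f := fun j => |C (Pi.single j 1)|) (fun _ _ => abs_nonneg _)
        (Finset.mem_univ j))
  have hdet : ∀ m : ℕ, ‖L.det‖ ^ m ≤
      (Fintype.card (Fin d)).factorial • B ^ Fintype.card (Fin d) := by
    intro m
    have := det_le (A := L ^ m) (abv := NormedField.toAbsoluteValue ℂ) (x := B) (hB m)
    rwa [det_pow, map_pow] at this
  by_contra! hlt
  obtain ⟨m, hm⟩ := pow_unbounded_of_one_lt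
    ((Fintype.card (Fin d)).factorial • B ^ Fintype.card (Fin d)) hlt
  exact absurd (hdet m) (not_le.2 hm)

theorem trace_vecMulVec_star {d : ℕ} (v : Fin d → ℂ) :
    (vecMulVec v (star v)).trace = ((∑ i, ‖v i‖ ^ 2 : ℝ) : ℂ) := by
  simp [trace, vecMulVec_apply, Complex.mul_conj, Complex.normSq_eq_norm_sq]

/-- An invertible matrix admitting a spanning forward orbit of constant norm has determinant of
modulus one. -/
theorem norm_det_eq_one_of_orbit {d : ℕ} (L : Matrix (Fin d) (Fin d) ℂ) (hL : IsUnit L.det)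
    (c : ℕ → Fin d → ℂ) (hc : ∀ k, L *ᵥ c k = c (k + 1)) (C : ℝ)
    (hC : ∀ k, ∑ i, ‖c k i‖ ^ 2 = C) (hspan : Submodule.span ℂ (Set.range c) = ⊤) :
    ‖L.det‖ = 1 := by
  have hentry : ∀ v : Fin d → ℂ, ∑ i, ‖v i‖ ^ 2 = C → ∀ i, ‖v i‖ ≤ Real.sqrt C := by
    intro v hv i
    apply Real.le_sqrt_of_sq_le
    rw [← hv]
    exact Finset.single_le_sum (f := fun i => ‖v i‖ ^ 2) (fun _ _ => by positivity)
      (Finset.mem_univ i)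
  have hpow : ∀ m k, (L ^ m) *ᵥ c k = c (k + m) := by
    intro m
    induction m with
    | zero => simp
    | succ m ih =>
      intro k
      rw [pow_succ, ← mulVec_mulVec, hc, ih]
      congr 1
      ring
  have hinv : ∀ m k, (L⁻¹ ^ (m + 1)) *ᵥ c (k + 1) = (L⁻¹ ^ m) *ᵥ c k := by
    intro m k
    rw [pow_succ, ← mulVec_mulVec, ← hc k, mulVec_mulVec (c k), nonsing_inv_mul _ hL, one_mulVec]
  have hback0 : ∀ m, ∑ i, ‖((L⁻¹ ^ m) *ᵥ c 0) i‖ ^ 2 = C := by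
    intro m
    let Λ : Matrix (Fin d) (Fin d) ℂ →ₗ[ℂ] Matrix (Fin d) (Fin d) ℂ :=
      LinearMap.mulLeft ℂ L ∘ₗ LinearMap.mulRight ℂ Lᴴ
    have hΛ : ∀ v : Fin d → ℂ, Λ (vecMulVec v (star v)) = vecMulVec (L *ᵥ v) (star (L *ᵥ v)) := by
      intro v
      simp only [Λ, LinearMap.comp_apply, LinearMap.mulLeft_apply, LinearMap.mulRight_apply,
        vecMulVec_mul, mul_vecMulVec, star_mulVec]
    have hLH : IsUnit Lᴴ.det := by
      rw [det_conjTranspose]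
      exact hL.star
    have hinj : Function.Injective Λ := by
      intro X Y hXY
      simp only [Λ, LinearMap.comp_apply, LinearMap.mulLeft_apply, LinearMap.mulRight_apply] at hXY
      have h1 := congrArg (fun Z => L⁻¹ * Z * Lᴴ⁻¹) hXY
      simpa [← Matrix.mul_assoc, nonsing_inv_mul _ hL, Matrix.mul_assoc _ Lᴴ,
        mul_nonsing_inv _ hLH] using h1
    have hiter : ∀ n : ℕ, (Λ ^ n) (vecMulVec (c 0) (star (c 0)))
        = vecMulVec (c n) (star (c n)) := by
      intro n
      induction n with
      | zero => simp
      | succ n ih => rw [pow_succ', Module.End.mul_apply, ih, hΛ, hc]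
    have := apply_const_of_forward_iterates Λ hinj (traceLinearMap (Fin d) ℂ ℂ)
      (fun m => vecMulVec ((L⁻¹ ^ m) *ᵥ c 0) (star ((L⁻¹ ^ m) *ᵥ c 0)))
      (vecMulVec (c 0) (star (c 0)))
      (fun m => by
        rw [hΛ, pow_succ', mulVec_mulVec, ← Matrix.mul_assoc, mul_nonsing_inv _ hL, Matrix.one_mul])
      (by simp) (fun n => by
        rw [hiter, traceLinearMap_apply, traceLinearMap_apply, trace_vecMulVec_star,
          trace_vecMulVec_star, hC, hC]) m
    rw [traceLinearMap_apply, traceLinearMap_apply, trace_vecMulVec_star, trace_vecMulVec_star,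
      hC] at this
    exact_mod_cast this
  have hback : ∀ k m, ∑ i, ‖((L⁻¹ ^ m) *ᵥ c k) i‖ ^ 2 = C := by
    intro k
    induction k with
    | zero => exact hback0
    | succ k ih =>
      intro m
      cases m with
      | zero => simpa using hC (k + 1)
      | succ m => simpa only [hinv] using ih m
  have h1 : ‖L.det‖ ≤ 1 := by
    apply norm_det_le_one_of_bounded_orbits
    rw [eq_top_iff, ← hspan]
    apply Submodule.span_mono
    rintro _ ⟨k, rfl⟩
    exact ⟨Real.sqrt C, fun m => hentry _ (by rw [hpow, hC])⟩
  have h2 : ‖L⁻¹.det‖ ≤ 1 := by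
    apply norm_det_le_one_of_bounded_orbits
    rw [eq_top_iff, ← hspan]
    apply Submodule.span_mono
    rintro _ ⟨k, rfl⟩
    exact ⟨Real.sqrt C, fun m => hentry _ (hback k m)⟩
  have h3 : ‖L.det‖ * ‖L⁻¹.det‖ = 1 := by
    rw [← norm_mul, ← det_mul, mul_nonsing_inv _ hL, det_one, norm_one]
  nlinarith [norm_nonneg L.det, norm_nonneg L⁻¹.det]

theorem norm_sq_det_of_gram {d : ℕ} (M : Matrix (Fin d) (Fin d) ℂ) (κ : Fin d → ℂ)
    (h : Mᴴ * M = 1 - vecMulVec κ (star κ)) :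
    ‖M.det‖ ^ 2 = 1 - ∑ i, ‖κ i‖ ^ 2 := by
  have h1 : (Mᴴ * M).det = 1 - ((∑ i, ‖κ i‖ ^ 2 : ℝ) : ℂ) := by
    rw [h, sub_eq_add_neg, ← neg_vecMulVec, vecMulVec_eq Unit,
      det_one_add_replicateCol_mul_replicateRow]
    simp [dotProduct, Complex.conj_mul', sub_eq_add_neg]
  rw [det_mul, det_conjTranspose, Complex.star_def, Complex.conj_mul'] at h1
  exact_mod_cast h1

theorem false_of_orbit_data {d : ℕ} {q : ℝ} (hq : 1 / 2 < q) (hq1 : q < 1)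
    (M : Matrix (Fin d) (Fin d) ℂ) (κ : Fin d → ℂ) (c : ℕ → Fin d → ℂ)
    (hM : Mᴴ * M = 1 - vecMulVec κ (star κ)) (hκ : ∑ i, ‖κ i‖ ^ 2 = q)
    (hc : ∀ k, M *ᵥ c k = c (k + 1)) (hC : ∀ k, ∑ i, ‖c k i‖ ^ 2 = q ^ (k + 1))
    (hspan : Submodule.span ℂ (Set.range c) = ⊤) (hd : (d : ℝ) = q / (1 - q)) : False := by
  have hq0 : 0 < q := by linarith
  have hs : 0 < Real.sqrt q := Real.sqrt_pos.2 hq0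
  set s : ℂ := (Real.sqrt q : ℂ) with hs_def
  have hs0 : s ≠ 0 := by simpa [s] using hs.ne'
  have hsn : ‖s‖ ^ 2 = q := by
    simp [s, Real.sq_sqrt hq0.le]
  have hdetM := norm_sq_det_of_gram M κ hM
  rw [hκ] at hdetM
  have hM0 : M.det ≠ 0 := by
    intro h0
    rw [h0] at hdetM
    norm_num at hdetM
    linarith
  have hdet : (s⁻¹ • M).det = s⁻¹ ^ d * M.det := by simp
  have key := norm_det_eq_one_of_orbit (s⁻¹ • M)
    (by rw [hdet, isUnit_iff_ne_zero]; exact mul_ne_zero (pow_ne_zero _ (inv_ne_zero hs0)) hM0)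
    (fun k => s⁻¹ ^ k • c k)
    (fun k => by rw [smul_mulVec, mulVec_smul, hc, smul_smul, ← pow_succ']) q
    (fun k => by
      simp only [Pi.smul_apply, smul_eq_mul, norm_mul, mul_pow, ← Finset.mul_sum, hC]
      rw [norm_pow, norm_inv, ← pow_mul, mul_comm k 2, pow_mul, inv_pow, hsn, inv_pow]
      field_simp
      ring)
    (by
      rw [eq_top_iff, ← hspan, Submodule.span_le]
      rintro _ ⟨k, rfl⟩
      have : c k = s ^ k • (s⁻¹ ^ k • c k) := by
        rw [smul_smul, ← mul_pow, mul_inv_cancel₀ hs0, one_pow, one_smul]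
      rw [this]
      exact Submodule.smul_mem _ _ (Submodule.subset_span ⟨k, rfl⟩))
  have hqd : 1 - q = q ^ d := by
    rw [hdet, norm_mul, norm_pow, norm_inv] at key
    have h2 : ((‖s‖⁻¹ ^ d) * ‖M.det‖) ^ 2 = 1 := by rw [key]; norm_num
    rw [mul_pow, hdetM, ← pow_mul, mul_comm d 2, pow_mul, inv_pow, hsn, inv_pow] at h2
    have : q ^ d ≠ 0 := by positivity
    field_simp at h2
    exact h2
  have hd1 : (d : ℝ) * (1 - q) = q := by
    rw [hd]; field_simp [(by linarith : 1 - q ≠ 0)]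
  have hd2 : 2 ≤ d := by
    by_contra! hlt
    have h2 : (d : ℝ) ≤ 1 := by exact_mod_cast Nat.lt_succ_iff.1 hlt
    nlinarith
  obtain ⟨e, rfl⟩ := Nat.exists_eq_add_of_le' hd2
  have hbern := one_add_mul_le_pow (a := q - 1) (by linarith) (e + 1)
  rw [add_sub_cancel] at hbern
  push_cast at hbern hd1
  have h3 : ((e : ℝ) + 2) * q ^ (e + 1) = 1 := by
    have h4 : (((e : ℝ) + 2) * q ^ (e + 1)) * q = 1 * q := by
      rw [mul_assoc, ← pow_succ, ← hqd, hd1, one_mul]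
    exact mul_right_cancel₀ hq0.ne' h4
  nlinarith [mul_le_mul_of_nonneg_left hbern (by positivity : (0 : ℝ) ≤ (e : ℝ) + 2)]

end Orbits

section Frame

open scoped InnerProductSpace

variable {H : Type*} [NormedAddCommGroup H] [InnerProductSpace ℂ H]

theorem inner_self_eq_ofReal (x : H) : ⟪x, x⟫_ℂ = ((‖x‖ ^ 2 : ℝ) : ℂ) := by
  rw [inner_self_eq_norm_sq_to_K]
  simp

theorem hasSum_norm_sq_inner_of_frame {w : ℕ → H} {x : H}
    (h : HasSum (fun k => ⟪w k, x⟫_ℂ • w k) x) : HasSum (fun k => ‖⟪w k, x⟫_ℂ‖ ^ 2) (‖x‖ ^ 2) := by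
  have h1 := h.mapL (innerSL ℂ x)
  have h2 := h1.mapL Complex.reCLM
  convert h2 using 1
  · ext k
    simp only [innerSL_apply_apply, inner_smul_right, Complex.reCLM_apply]
    rw [← inner_conj_symm x (w k), Complex.mul_conj, Complex.ofReal_re, Complex.normSq_eq_norm_sq]
  · rw [innerSL_apply_apply, inner_self_eq_ofReal, Complex.reCLM_apply, Complex.ofReal_re]

/-- Summing a Parseval frame against an orthonormal basis of a finite-dimensional subspace
computes its dimension. -/
theorem hasSum_finrank_of_frame {w : ℕ → H} (V : Submodule ℂ H) [FiniteDimensional ℂ V]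
    (hV : ∀ x ∈ V, HasSum (fun k => ⟪w k, x⟫_ℂ • w k) x) :
    HasSum (fun k => ∑ l, ‖⟪w k, (stdOrthonormalBasis ℂ V l : H)⟫_ℂ‖ ^ 2)
      (Module.finrank ℂ V : ℝ) := by
  have h := hasSum_sum (s := Finset.univ) (fun l _ => hasSum_norm_sq_inner_of_frame
    (hV (stdOrthonormalBasis ℂ V l : H) (stdOrthonormalBasis ℂ V l).2))
  convert h using 1
  have h1 : ∀ l, ‖(stdOrthonormalBasis ℂ V l : H)‖ = 1 := (stdOrthonormalBasis ℂ V).orthonormal.1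
  simp [h1]

theorem finrank_le_of_frame {w : ℕ → H} {D : ℝ} (hD : HasSum (fun k => ‖w k‖ ^ 2) D)
    (V : Submodule ℂ H) [FiniteDimensional ℂ V]
    (hV : ∀ x ∈ V, HasSum (fun k => ⟪w k, x⟫_ℂ • w k) x) : (Module.finrank ℂ V : ℝ) ≤ D := by
  refine hasSum_le (fun k => ?_) (hasSum_finrank_of_frame V hV) hD
  have hon : Orthonormal ℂ (fun l => (stdOrthonormalBasis ℂ V l : H)) :=
    (stdOrthonormalBasis ℂ V).orthonormal.comp_linearIsometry V.subtypeₗᵢ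
  simpa only [norm_inner_symm] using hon.sum_inner_products_le (w k) (s := Finset.univ)

/-- The span of a Parseval frame with `∑ ‖w k‖² = D` has finite dimension `D`. -/
theorem exists_orthonormal_of_frame {w : ℕ → H} {D : ℝ} (hD : HasSum (fun k => ‖w k‖ ^ 2) D)
    (hw : ∀ x ∈ Submodule.span ℂ (Set.range w), HasSum (fun k => ⟪w k, x⟫_ℂ • w k) x) :
    ∃ (d : ℕ) (u : Fin d → H), (d : ℝ) = D ∧ Orthonormal ℂ u ∧
      (∀ l, u l ∈ Submodule.span ℂ (Set.range w)) ∧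
      ∀ x ∈ Submodule.span ℂ (Set.range w), ∑ l, ⟪u l, x⟫_ℂ • u l = x := by
  set W := Submodule.span ℂ (Set.range w) with hW
  have hfin : FiniteDimensional ℂ W := by
    rw [FiniteDimensional, ← Module.rank_lt_aleph0_iff]
    refine (rank_le (n := ⌊D⌋₊) fun s hs => ?_).trans_lt (Cardinal.natCast_lt_aleph0)
    let V : Submodule ℂ H := Submodule.span ℂ (Set.range fun i : s => ((i : W) : H))
    have : FiniteDimensional ℂ V := FiniteDimensional.span_of_finite ℂ (Set.finite_range _)
    have hs' : LinearIndependent ℂ fun i : s => ((i : W) : H) :=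
      hs.map' W.subtype (Submodule.ker_subtype W)
    have hVW : V ≤ W := by
      rw [Submodule.span_le]
      rintro _ ⟨i, rfl⟩
      exact (i : W).2
    have h1 := finrank_le_of_frame hD V (fun x hx => hw x (hVW hx))
    rw [finrank_span_eq_card hs', Fintype.card_coe] at h1
    exact Nat.le_floor h1
  let b := stdOrthonormalBasis ℂ W
  have hon : Orthonormal ℂ (fun l => (b l : H)) :=
    b.orthonormal.comp_linearIsometry W.subtypeₗᵢ
  refine ⟨Module.finrank ℂ W, fun l => (b l : H), ?_, hon, fun l => (b l).2, fun x hx => ?_⟩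
  · refine (hasSum_finrank_of_frame W hw).unique ?_
    convert hD using 1
    ext k
    exact b.sum_sq_norm_inner_left ⟨w k, Submodule.subset_span ⟨k, rfl⟩⟩
  · have := congrArg (W.subtype) (b.sum_repr' ⟨x, hx⟩)
    simpa using this

end Frame

section Shift

open Matrix
open scoped InnerProductSpace

/-- The space of square-summable sequences. -/
noncomputable abbrev L2Seq := lp (fun _ : ℕ => ℂ) 2

theorem memLp_two_iff {x : ℕ → ℂ} : Memℓp x 2 ↔ Summable fun i => ‖x i‖ ^ 2 := by
  rw [memℓp_gen_iff (by norm_num)]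
  norm_num

/-- The coordinate functionals on square-summable sequences. -/
noncomputable def coord (n : ℕ) : L2Seq →L[ℂ] ℂ := lp.evalCLM ℂ (fun _ : ℕ => ℂ) 2 n

theorem coord_ext {x y : L2Seq} (h : ∀ n, coord n x = coord n y) : x = y :=
  lp.ext (funext h)

theorem exists_coord_eq {x : ℕ → ℂ} (hx : Summable fun i => ‖x i‖ ^ 2) :
    ∃ y : L2Seq, ∀ n, coord n y = x n :=
  ⟨⟨x, memLp_two_iff.2 hx⟩, fun _ => rfl⟩

theorem hasSum_coord_inner (x y : L2Seq) :
    HasSum (fun n => starRingEnd ℂ (coord n x) * coord n y) ⟪x, y⟫_ℂ := by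
  have h : HasSum (fun n => coord n y * starRingEnd ℂ (coord n x)) ⟪x, y⟫_ℂ :=
    lp.hasSum_inner (𝕜 := ℂ) x y
  simpa only [mul_comm] using h

theorem hasSum_norm_sq_coord (x : L2Seq) : HasSum (fun n => ‖coord n x‖ ^ 2) (‖x‖ ^ 2) := by
  have h : HasSum (fun n => ‖coord n x‖ ^ (2 : ENNReal).toReal) (‖x‖ ^ (2 : ENNReal).toReal) :=
    lp.hasSum_norm (p := 2) (by norm_num) x
  norm_num at h
  exact h

/-- The backward shift on square-summable sequences. -/
noncomputable def backwardShift : L2Seq →ₗ[ℂ] L2Seq where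
  toFun x := ⟨fun i => coord (i + 1) x, memLp_two_iff.2
    ((summable_nat_add_iff 1).2 (hasSum_norm_sq_coord x).summable)⟩
  map_add' _ _ := rfl
  map_smul' _ _ := rfl

theorem coord_backwardShift (n : ℕ) (x : L2Seq) :
    coord n (backwardShift x) = coord (n + 1) x := rfl

theorem inner_eq_add_inner_backwardShift (x y : L2Seq) :
    ⟪x, y⟫_ℂ = starRingEnd ℂ (coord 0 x) * coord 0 y + ⟪backwardShift x, backwardShift y⟫_ℂ := by
  rw [← (hasSum_coord_inner x y).tsum_eq, (hasSum_coord_inner x y).summable.tsum_eq_zero_add,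
    ← (hasSum_coord_inner (backwardShift x) (backwardShift y)).tsum_eq]
  rfl

/-- The tail `n ↦ a (k + n)` of a square-summable sequence. -/
noncomputable def tailSeq (a : L2Seq) (k : ℕ) : L2Seq := (backwardShift ^ k) a

theorem coord_tailSeq (a : L2Seq) (k n : ℕ) : coord n (tailSeq a k) = coord (k + n) a := by
  induction k generalizing n with
  | zero => simp [tailSeq]
  | succ k ih =>
    rw [tailSeq, pow_succ', Module.End.mul_apply, coord_backwardShift, ← tailSeq, ih,
      Nat.add_right_comm, Nat.add_assoc]

theorem backwardShift_tailSeq (a : L2Seq) (k : ℕ) :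
    backwardShift (tailSeq a k) = tailSeq a (k + 1) := by
  rw [tailSeq, tailSeq, pow_succ', Module.End.mul_apply]

theorem inner_tailSeq (a : L2Seq) (k j : ℕ) :
    ⟪tailSeq a k, tailSeq a j⟫_ℂ
      = starRingEnd ℂ (coord k a) * coord j a + ⟪tailSeq a (k + 1), tailSeq a (j + 1)⟫_ℂ := by
  rw [inner_eq_add_inner_backwardShift, backwardShift_tailSeq, backwardShift_tailSeq,
    coord_tailSeq, coord_tailSeq, add_zero, add_zero]

theorem norm_sq_tailSeq {a : L2Seq} {q : ℝ} (hq0 : 0 < q) (hq1 : q < 1)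
    (ha : ∀ n, ‖coord n a‖ ^ 2 = (1 - q) * q ^ n) (k : ℕ) : ‖tailSeq a k‖ ^ 2 = q ^ k := by
  rw [← (hasSum_norm_sq_coord _).tsum_eq]
  simp only [coord_tailSeq, ha, pow_add, ← mul_assoc]
  rw [tsum_mul_left, tsum_geometric_of_lt_one hq0.le hq1]
  field_simp [(by linarith : 1 - q ≠ 0)]

theorem hasSum_reproducing {a : L2Seq} (ha : ⟪a, a⟫_ℂ = 1)
    (hc : ∀ k, ⟪a, tailSeq a (k + 1)⟫_ℂ = 0) (i j : ℕ) :
    HasSum (fun k => ⟪tailSeq a (k + 1), tailSeq a (j + 1)⟫_ℂ * coord (k + 1 + i) a)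
      (coord (j + 1 + i) a) := by
  have ha0 : tailSeq a 0 = a := by simp [tailSeq]
  have hsub : ∀ i j, HasSum (fun k => ⟪tailSeq a k, tailSeq a j⟫_ℂ * coord (k + 1 + i) a)
        (coord (j + 1 + i) a) →
      HasSum (fun k => ⟪tailSeq a (k + 1), tailSeq a (j + 1)⟫_ℂ * coord (k + 1 + i) a)
        (coord (j + 1 + i) a) := by
    intro i j h
    have h1 := (hasSum_coord_inner a (tailSeq a (i + 1))).mul_left (coord j a)
    rw [hc, mul_zero] at h1
    have h2 := h.sub h1
    rw [sub_zero] at h2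
    refine (congrArg (HasSum · _) (funext fun k => ?_)).mpr h2
    rw [inner_tailSeq a k j, coord_tailSeq, show i + 1 + k = k + 1 + i by ring]
    ring
  induction j generalizing i with
  | zero =>
    apply hsub
    convert hasSum_single 0 ?_ using 1
    · rw [ha0, ha, one_mul]
    · intro k hk
      obtain ⟨k, rfl⟩ := Nat.exists_eq_succ_of_ne_zero hk
      rw [ha0, ← inner_conj_symm, Nat.succ_eq_add_one, hc, map_zero, zero_mul]
  | succ j ih =>
    apply hsub
    rw [← hasSum_nat_add_iff' 1, Finset.sum_range_one, ha0, hc, zero_mul, sub_zero,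
      show j + 1 + 1 + i = j + 1 + (i + 1) by ring]
    refine (congrArg (HasSum · _) (funext fun k => ?_)).mpr (ih (i + 1))
    rw [show k + 1 + 1 + i = k + 1 + (i + 1) by ring]

theorem hasSum_frame_tailSeq {a : L2Seq} {q : ℝ} (hq0 : 0 < q) (hq1 : q < 1)
    (ha : ∀ n, ‖coord n a‖ ^ 2 = (1 - q) * q ^ n) (hc : ∀ k, ⟪a, tailSeq a (k + 1)⟫_ℂ = 0)
    (x : L2Seq)
    (hx : x ∈ Submodule.span ℂ (Set.range fun k => tailSeq a (k + 1))) :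
    HasSum (fun k => ⟪tailSeq a (k + 1), x⟫_ℂ • tailSeq a (k + 1)) x := by
  have haa : ⟪a, a⟫_ℂ = 1 := by
    have h := norm_sq_tailSeq hq0 hq1 ha 0
    simp only [tailSeq, pow_zero, Module.End.one_apply] at h
    rw [inner_self_eq_ofReal, h, Complex.ofReal_one]
  induction hx using Submodule.span_induction with
  | mem x hx =>
    obtain ⟨j, rfl⟩ := hx
    have hle : ∀ k, ‖⟪tailSeq a (k + 1), tailSeq a (j + 1)⟫_ℂ • tailSeq a (k + 1)‖
        ≤ q ^ k * ‖tailSeq a (j + 1)‖ := by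
      intro k
      rw [norm_smul]
      calc _ ≤ ‖tailSeq a (k + 1)‖ * ‖tailSeq a (j + 1)‖ * ‖tailSeq a (k + 1)‖ :=
            mul_le_mul_of_nonneg_right (norm_inner_le_norm _ _) (norm_nonneg _)
        _ = ‖tailSeq a (k + 1)‖ ^ 2 * ‖tailSeq a (j + 1)‖ := by ring
        _ ≤ _ := by
            rw [norm_sq_tailSeq hq0 hq1 ha]
            exact mul_le_mul_of_nonneg_right (pow_le_pow_of_le_one hq0.le hq1.le k.le_succ)
              (norm_nonneg _)
    have hs : Summable fun k => ⟪tailSeq a (k + 1), tailSeq a (j + 1)⟫_ℂ • tailSeq a (k + 1) :=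
      Summable.of_norm_bounded ((summable_geometric_of_lt_one hq0.le hq1).mul_right _) hle
    convert hs.hasSum using 1
    refine coord_ext fun i => ?_
    have h1 := hs.hasSum.mapL (coord i)
    have h2 := hasSum_reproducing haa hc i j
    rw [coord_tailSeq]
    refine h2.unique ?_
    simpa [coord_tailSeq] using h1
  | zero => simp
  | add x y _ _ hx hy => simpa only [inner_add_right, add_smul] using hx.add hy
  | smul c x _ hx => simpa only [inner_smul_right, mul_smul] using hx.const_smul c

/-- There is no sequence with `‖a n‖² = (1 - q) qⁿ`, `1/2 < q < 1`, whose nontrivial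
autocorrelations all vanish. -/
theorem false_of_geometric_autocorrelation {a : L2Seq} {q : ℝ} (hq : 1 / 2 < q) (hq1 : q < 1)
    (ha : ∀ n, ‖coord n a‖ ^ 2 = (1 - q) * q ^ n) (hc : ∀ k, ⟪a, tailSeq a (k + 1)⟫_ℂ = 0) :
    False := by
  have hq0 : 0 < q := by linarith
  have hframe := hasSum_frame_tailSeq hq0 hq1 ha hc
  set w : ℕ → L2Seq := fun k => tailSeq a (k + 1) with hw
  have hD : HasSum (fun k => ‖w k‖ ^ 2) (q / (1 - q)) := by
    simp only [hw, norm_sq_tailSeq hq0 hq1 ha, pow_succ', div_eq_mul_inv]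
    exact (hasSum_geometric_of_lt_one hq0.le hq1).mul_left q
  obtain ⟨d, u, hd, hu, huW, hux⟩ := exists_orthonormal_of_frame hD hframe
  have hwW : ∀ k, w k ∈ Submodule.span ℂ (Set.range w) := fun k => Submodule.subset_span ⟨k, rfl⟩
  have hinner : ∀ x ∈ Submodule.span ℂ (Set.range w), ∀ y,
      ∑ l, ⟪u l, x⟫_ℂ * ⟪y, u l⟫_ℂ = ⟪y, x⟫_ℂ := by
    intro x hx y
    conv_rhs => rw [← hux x hx]
    simp
  have hnorm : ∀ x ∈ Submodule.span ℂ (Set.range w), ∑ l, ‖⟪u l, x⟫_ℂ‖ ^ 2 = ‖x‖ ^ 2 := by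
    intro x hx
    have h1 := hinner x hx x
    rw [inner_self_eq_ofReal] at h1
    have h2 : ∀ l, ⟪u l, x⟫_ℂ * ⟪x, u l⟫_ℂ = ((‖⟪u l, x⟫_ℂ‖ ^ 2 : ℝ) : ℂ) := fun l => by
      rw [← inner_conj_symm x (u l), Complex.mul_conj, Complex.normSq_eq_norm_sq]
    simp only [h2] at h1
    exact_mod_cast h1
  have hBW : ∀ x ∈ Submodule.span ℂ (Set.range w),
      backwardShift x ∈ Submodule.span ℂ (Set.range w) := by
    intro x hx
    induction hx using Submodule.span_induction with
    | mem x hx =>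
      obtain ⟨k, rfl⟩ := hx
      simp only [hw, backwardShift_tailSeq]
      exact hwW (k + 1)
    | zero => simp
    | add x y _ _ hx hy => rw [map_add]; exact Submodule.add_mem _ hx hy
    | smul c x _ hx => rw [map_smul]; exact Submodule.smul_mem _ _ hx
  have hκ : ∑ l, ‖starRingEnd ℂ (coord 0 (u l))‖ ^ 2 = q := by
    let e : L2Seq := ∑ l, starRingEnd ℂ (coord 0 (u l)) • u l
    have heW : e ∈ Submodule.span ℂ (Set.range w) :=
      Submodule.sum_mem _ fun l _ => Submodule.smul_mem _ _ (huW l)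
    have he : ∀ x ∈ Submodule.span ℂ (Set.range w), ⟪e, x⟫_ℂ = coord 0 x := by
      intro x hx
      have h1 := congrArg (coord 0) (hux x hx)
      rw [map_sum] at h1
      simp only [map_smul, smul_eq_mul] at h1
      refine Eq.trans ?_ h1
      simp only [e, sum_inner, inner_smul_left, RingHomCompTriple.comp_apply, RingHom.id_apply]
      exact Finset.sum_congr rfl fun l _ => mul_comm _ _
    have h1 : ∑ l, ‖starRingEnd ℂ (coord 0 (u l))‖ ^ 2 = ‖e‖ ^ 2 := by
      rw [← hnorm e heW]
      refine Finset.sum_congr rfl fun l _ => ?_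
      rw [← inner_conj_symm, he _ (huW l)]
    rw [h1]
    refine (hasSum_norm_sq_inner_of_frame (hframe e heW)).unique ?_
    have h2 : HasSum (fun k => (1 - q) * q * q ^ k) ((1 - q) * q * (1 - q)⁻¹) :=
      (hasSum_geometric_of_lt_one hq0.le hq1).mul_left _
    convert h2 using 1
    · ext k
      rw [norm_inner_symm, he _ (hwW k)]
      simp only [hw, coord_tailSeq, add_zero, ha]
      ring
    · field_simp [(by linarith : 1 - q ≠ 0)]
  refine false_of_orbit_data hq hq1 (Matrix.of fun l j => ⟪u l, backwardShift (u j)⟫_ℂ)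
    (fun l => starRingEnd ℂ (coord 0 (u l))) (fun k l => ⟪u l, w k⟫_ℂ) ?_ hκ ?_ ?_ ?_ hd
  · ext i j
    have h1 := hinner _ (hBW _ (huW j)) (backwardShift (u i))
    have h2 := inner_eq_add_inner_backwardShift (u i) (u j)
    rw [orthonormal_iff_ite.1 hu i j] at h2
    simp only [mul_apply, conjTranspose_apply, of_apply, Matrix.sub_apply, Matrix.one_apply,
      vecMulVec_apply, Pi.star_apply, RCLike.star_def, inner_conj_symm,
      RingHomCompTriple.comp_apply, RingHom.id_apply]
    rw [h2, add_sub_cancel_left, ← h1]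
    exact Finset.sum_congr rfl fun l _ => mul_comm _ _
  · intro k
    ext l
    have h1 : ⟪u l, backwardShift (w k)⟫_ℂ = ⟪u l, w (k + 1)⟫_ℂ := by
      simp only [hw, backwardShift_tailSeq]
    rw [← h1]
    conv_rhs => rw [← hux _ (hwW k)]
    simp [mulVec, dotProduct, mul_comm]
  · intro k
    rw [hnorm _ (hwW k)]
    exact norm_sq_tailSeq hq0 hq1 ha (k + 1)
  · let T : L2Seq →ₗ[ℂ] (Fin d → ℂ) := LinearMap.pi fun l => (innerSL ℂ (u l)).toLinearMap
    have hT : (Submodule.span ℂ (Set.range w)).map T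
        = Submodule.span ℂ (Set.range fun k l => ⟪u l, w k⟫_ℂ) := by
      rw [Submodule.map_span, ← Set.range_comp]
      rfl
    rw [← hT, eq_top_iff]
    intro y _
    refine ⟨∑ j, y j • u j, Submodule.sum_mem _ fun j _ => Submodule.smul_mem _ _ (huW j), ?_⟩
    ext l
    simp [T, orthonormal_iff_ite.1 hu]

end Shift

section Circle

open MeasureTheory AddCircle Filter Topology

theorem integral_fourier_eq_ite (n : ℤ) :
    ∫ t : AddCircle (1 : ℝ), fourier n t ∂haarAddCircle = if n = 0 then 1 else 0 := by
  have h := congrFun (fourierCoeff_fourier (T := 1) n) 0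
  simpa [fourierCoeff, Pi.single_apply, eq_comm] using h

/-- The boundary values of a power series with summable coefficients. -/
noncomputable def boundaryValue (a : ℕ → ℂ) (t : AddCircle (1 : ℝ)) : ℂ :=
  ∑' n : ℕ, a n * fourier (n : ℤ) t

theorem norm_fourier_apply (n : ℤ) (t : AddCircle (1 : ℝ)) : ‖fourier n t‖ = 1 := by
  rw [fourier_apply]
  exact Circle.norm_coe _

theorem fourier_eq_pow (n : ℕ) (t : AddCircle (1 : ℝ)) : fourier (n : ℤ) t = fourier 1 t ^ n := by
  induction n with
  | zero => simp
  | succ n ih => rw [Nat.cast_succ, fourier_add, ih, pow_succ]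

theorem continuous_boundaryValue {a : ℕ → ℂ} (ha : Summable fun n => ‖a n‖) :
    Continuous (boundaryValue a) := by
  refine continuous_tsum (fun n => continuous_const.mul (fourier (n : ℤ)).continuous) ha
    fun n t => ?_
  rw [norm_mul, norm_fourier_apply, mul_one]

theorem integrable_of_continuous {E : Type*} [NormedAddCommGroup E] {g : AddCircle (1 : ℝ) → E}
    (hg : Continuous g) : Integrable g haarAddCircle :=
  hg.integrable_of_hasCompactSupport (HasCompactSupport.of_compactSpace g)

theorem hasSum_integral_boundaryValue_mul {a : ℕ → ℂ} (ha : Summable fun n => ‖a n‖)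
    {g : AddCircle (1 : ℝ) → ℂ} (hg : Continuous g) :
    HasSum (fun n : ℕ => a n * ∫ t, fourier (n : ℤ) t * g t ∂haarAddCircle)
      (∫ t, boundaryValue a t * g t ∂haarAddCircle) := by
  have hcont : ∀ n : ℕ, Continuous fun t => a n * (fourier (n : ℤ) t * g t) := fun n =>
    continuous_const.mul ((fourier (n : ℤ)).continuous.mul hg)
  have h := hasSum_integral_of_summable_integral_norm (μ := haarAddCircle)
    (fun n => integrable_of_continuous (hcont n)) (by
      simp only [norm_mul, norm_fourier_apply, one_mul, integral_const_mul]
      exact ha.mul_right _)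
  simp only [integral_const_mul] at h
  have hval : ∫ t, boundaryValue a t * g t ∂haarAddCircle
      = ∫ t, ∑' n : ℕ, a n * (fourier (n : ℤ) t * g t) ∂haarAddCircle := by
    refine integral_congr_ae (Eventually.of_forall fun t => ?_)
    simp only [← mul_assoc]
    rw [tsum_mul_right, boundaryValue]
  rwa [hval]

theorem integral_boundaryValue_mul_fourier {a : ℕ → ℂ} (ha : Summable fun n => ‖a n‖) (m : ℤ) :
    HasSum (fun n : ℕ => a n * if (n : ℤ) = m then 1 else 0)
      (∫ t, boundaryValue a t * fourier (-m) t ∂haarAddCircle) := by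
  have h := hasSum_integral_boundaryValue_mul ha (fourier (-m)).continuous
  simpa only [← fourier_add, integral_fourier_eq_ite, ← sub_eq_add_neg, sub_eq_zero] using h

theorem integral_boundaryValue_mul_fourier_nat {a : ℕ → ℂ} (ha : Summable fun n => ‖a n‖)
    (n : ℕ) : ∫ t, boundaryValue a t * fourier (-(n : ℤ)) t ∂haarAddCircle = a n := by
  refine (integral_boundaryValue_mul_fourier ha n).unique ?_
  convert hasSum_single n ?_ using 1
  · simp
  · intro k hk
    simp [hk]

theorem integral_boundaryValue_mul_fourier_of_neg {a : ℕ → ℂ} (ha : Summable fun n => ‖a n‖)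
    {m : ℤ} (hm : m < 0) : ∫ t, boundaryValue a t * fourier (-m) t ∂haarAddCircle = 0 := by
  refine (integral_boundaryValue_mul_fourier ha m).unique ?_
  convert hasSum_zero using 2 with n
  rw [if_neg (by omega), mul_zero]

/-- The Fourier coefficients of `|F|²` are the autocorrelations of the coefficients of `F`. -/
theorem hasSum_autocorrelation {a : ℕ → ℂ} (ha : Summable fun n => ‖a n‖) (k : ℕ) :
    HasSum (fun n => a (n + k) * starRingEnd ℂ (a n))
      (∫ t, ((‖boundaryValue a t‖ ^ 2 : ℝ) : ℂ) * fourier (-(k : ℤ)) t ∂haarAddCircle) := by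
  have hF := continuous_boundaryValue ha
  have h := hasSum_integral_boundaryValue_mul ha
    (g := fun t => starRingEnd ℂ (boundaryValue a t) * fourier (-(k : ℤ)) t)
    ((Complex.continuous_conj.comp hF).mul (fourier (-(k : ℤ))).continuous)
  have h1 : ∀ n : ℕ, ∫ t, fourier (n : ℤ) t *
      (starRingEnd ℂ (boundaryValue a t) * fourier (-(k : ℤ)) t) ∂haarAddCircle
      = starRingEnd ℂ (∫ t, boundaryValue a t * fourier (-((n : ℤ) - k)) t ∂haarAddCircle) := by
    intro n
    rw [← integral_conj]
    refine integral_congr_ae (Eventually.of_forall fun t => ?_)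
    simp only
    rw [map_mul, ← fourier_neg, neg_neg, sub_eq_add_neg, fourier_add]
    ring
  simp only [h1] at h
  rw [← hasSum_nat_add_iff' k, Finset.sum_eq_zero, sub_zero] at h
  · simpa only [Nat.cast_add, add_sub_cancel_right, integral_boundaryValue_mul_fourier_nat ha,
      ← mul_assoc, Complex.mul_conj, Complex.normSq_eq_norm_sq] using h
  · intro n hn
    rw [integral_boundaryValue_mul_fourier_of_neg ha (by simp at hn; omega), map_zero, mul_zero]

theorem hasSum_norm_sq_boundaryValue {a : ℕ → ℂ} (ha : Summable fun n => ‖a n‖) :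
    HasSum (fun n => ‖a n‖ ^ 2) (∫ t, ‖boundaryValue a t‖ ^ 2 ∂haarAddCircle) := by
  have h := hasSum_autocorrelation ha 0
  simp only [Nat.cast_zero, neg_zero, fourier_zero, mul_one, add_zero, Complex.mul_conj,
    Complex.normSq_eq_norm_sq, integral_complex_ofReal] at h
  exact_mod_cast h

/-- A power series with boundary values bounded by one and of mean square one has vanishing
nontrivial autocorrelations. -/
theorem integral_norm_sq_mul_fourier_eq_zero {a : ℕ → ℂ} (ha : Summable fun n => ‖a n‖)
    (hle : ∀ t, ‖boundaryValue a t‖ ≤ 1)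
    (hone : ∫ t, ‖boundaryValue a t‖ ^ 2 ∂haarAddCircle = 1) {m : ℤ} (hm : m ≠ 0) :
    ∫ t, ((‖boundaryValue a t‖ ^ 2 : ℝ) : ℂ) * fourier m t ∂haarAddCircle = 0 := by
  have hc : Continuous fun t => ‖boundaryValue a t‖ ^ 2 :=
    (continuous_boundaryValue ha).norm.pow 2
  have h1 : ∫ t, ((‖boundaryValue a t‖ ^ 2 : ℝ) : ℂ) * fourier m t ∂haarAddCircle
      = ∫ t, ((‖boundaryValue a t‖ ^ 2 - 1 : ℝ) : ℂ) * fourier m t ∂haarAddCircle := by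
    have h2 := integral_fourier_eq_ite m
    rw [if_neg hm] at h2
    have hint : Integrable (fun t => ((‖boundaryValue a t‖ ^ 2 : ℝ) : ℂ) * fourier m t)
        haarAddCircle :=
      integrable_of_continuous ((Complex.continuous_ofReal.comp hc).mul (fourier m).continuous)
    rw [← sub_zero (∫ t, ((‖boundaryValue a t‖ ^ 2 : ℝ) : ℂ) * fourier m t ∂haarAddCircle), ← h2,
      ← integral_sub hint (integrable_of_continuous (fourier m).continuous)]
    refine integral_congr_ae (Eventually.of_forall fun t => ?_)
    push_cast
    ring
  rw [h1, ← norm_le_zero_iff]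
  calc _ ≤ ∫ t, ‖((‖boundaryValue a t‖ ^ 2 - 1 : ℝ) : ℂ) * fourier m t‖ ∂haarAddCircle :=
        norm_integral_le_integral_norm _
    _ = ∫ t, (1 - ‖boundaryValue a t‖ ^ 2) ∂haarAddCircle := by
        refine integral_congr_ae (Eventually.of_forall fun t => ?_)
        simp only
        rw [norm_mul, norm_fourier_apply, mul_one, Complex.norm_real, Real.norm_eq_abs,
          abs_of_nonpos (by nlinarith [hle t, norm_nonneg (boundaryValue a t)])]
        ring
    _ = 0 := by
        rw [integral_sub (integrable_const _) (integrable_of_continuous hc), hone]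
        simp
    _ ≤ 0 := le_rfl

theorem summable_norm_mul_pow {a : ℕ → ℂ} (h : ∀ z : ℂ, ‖z‖ < 1 → Summable fun n => a n * z ^ n)
    {ρ : ℝ} (h0 : 0 ≤ ρ) (h1 : ρ < 1) : Summable fun n => ‖a n‖ * ρ ^ n := by
  have h2 := (h (ρ : ℂ) (by rwa [Complex.norm_real, Real.norm_of_nonneg h0])).norm
  simpa [abs_of_nonneg h0] using h2

/-- Gutzmer's inequality for a bounded power series. -/
theorem sum_norm_sq_le_of_bounded {a : ℕ → ℂ} {f : ℂ → ℂ} {C : ℝ}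
    (h : ∀ z : ℂ, ‖z‖ < 1 → HasSum (fun n : ℕ => a n * z ^ n) (f z))
    (hf : ∀ z : ℂ, ‖z‖ < 1 → ‖f z‖ ≤ C) (N : ℕ) : ∑ n ∈ Finset.range N, ‖a n‖ ^ 2 ≤ C ^ 2 := by
  have hρ : ∀ ρ : ℝ, 0 ≤ ρ → ρ < 1 → ∑ n ∈ Finset.range N, (‖a n‖ * ρ ^ n) ^ 2 ≤ C ^ 2 := by
    intro ρ h0 h1
    let b : ℕ → ℂ := fun n => a n * (ρ : ℂ) ^ n
    have hbn : ∀ n, ‖b n‖ = ‖a n‖ * ρ ^ n := fun n => by simp [b, abs_of_nonneg h0]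
    have hb : Summable fun n => ‖b n‖ := by
      simp only [hbn]
      exact summable_norm_mul_pow (fun z hz => (h z hz).summable) h0 h1
    have hbv : ∀ t, ‖boundaryValue b t‖ ≤ C := by
      intro t
      have hz : ‖(ρ : ℂ) * fourier 1 t‖ < 1 := by
        rwa [norm_mul, norm_fourier_apply, mul_one, Complex.norm_real, Real.norm_of_nonneg h0]
      convert hf _ hz using 2
      rw [← (h _ hz).tsum_eq, boundaryValue]
      refine tsum_congr fun n => ?_
      rw [fourier_eq_pow, mul_pow, mul_assoc]
    have hs := hasSum_norm_sq_boundaryValue hb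
    have h3 := sum_le_hasSum (Finset.range N) (fun _ _ => by positivity) hs
    simp only [hbn] at h3
    refine h3.trans ?_
    calc _ ≤ ∫ _t : AddCircle (1 : ℝ), C ^ 2 ∂haarAddCircle := by
          refine integral_mono (integrable_of_continuous ((continuous_boundaryValue hb).norm.pow 2))
            (integrable_const _) fun t => ?_
          exact pow_le_pow_left₀ (norm_nonneg _) (hbv t) 2
      _ = C ^ 2 := by simp
  have hlim : Tendsto (fun ρ : ℝ => ∑ n ∈ Finset.range N, (‖a n‖ * ρ ^ n) ^ 2) (𝓝[<] 1)
      (𝓝 (∑ n ∈ Finset.range N, ‖a n‖ ^ 2)) := by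
    have hcont : Continuous fun ρ : ℝ => ∑ n ∈ Finset.range N, (‖a n‖ * ρ ^ n) ^ 2 := by fun_prop
    have := (hcont.tendsto 1).mono_left (nhdsWithin_le_nhds (s := Set.Iio 1))
    simpa using this
  refine le_of_tendsto hlim ?_
  filter_upwards [Ioo_mem_nhdsLT (zero_lt_one (α := ℝ))] with ρ hρ'
  exact hρ ρ hρ'.1.le hρ'.2

theorem norm_coeff_le_of_bounded {a : ℕ → ℂ} {f : ℂ → ℂ} {C : ℝ}
    (h : ∀ z : ℂ, ‖z‖ < 1 → HasSum (fun n : ℕ => a n * z ^ n) (f z))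
    (hf : ∀ z : ℂ, ‖z‖ < 1 → ‖f z‖ ≤ C) (n : ℕ) : ‖a n‖ ≤ C := by
  have hC : 0 ≤ C := (norm_nonneg _).trans (hf 0 (by simp))
  refine (sq_le_sq₀ (norm_nonneg _) hC).1 ?_
  refine le_trans ?_ (sum_norm_sq_le_of_bounded h hf (n + 1))
  exact Finset.single_le_sum (f := fun n => ‖a n‖ ^ 2) (fun _ _ => by positivity)
    (Finset.self_mem_range_succ n)

theorem summable_of_norm_le_one {a : ℕ → ℂ} (ha : ∀ n, ‖a n‖ ≤ 1) {z : ℂ} (hz : ‖z‖ < 1) :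
    Summable fun n => a n * z ^ n := by
  refine Summable.of_norm_bounded (summable_geometric_of_lt_one (norm_nonneg z) hz) fun n => ?_
  rw [norm_mul, norm_pow]
  exact mul_le_of_le_one_left (by positivity) (ha n)

/-- Boundary values inherit the bound of the power series inside the disk. -/
theorem norm_boundaryValue_le {a : ℕ → ℂ} (ha : Summable fun n => ‖a n‖)
    (hf : ∀ z : ℂ, ‖z‖ < 1 → ‖∑' n, a n * z ^ n‖ ≤ 1) (t : AddCircle (1 : ℝ)) :
    ‖boundaryValue a t‖ ≤ 1 := by
  have hlim : Tendsto (fun ρ : ℝ => ∑' n, a n * ((ρ : ℂ) * fourier 1 t) ^ n) (𝓝[<] 1)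
      (𝓝 (boundaryValue a t)) := by
    refine tendsto_tsum_of_dominated_convergence ha (fun n => ?_) ?_
    · have hcont : Continuous fun ρ : ℝ => a n * ((ρ : ℂ) * fourier 1 t) ^ n := by fun_prop
      have := (hcont.tendsto 1).mono_left (nhdsWithin_le_nhds (s := Set.Iio 1))
      simp only [fourier_eq_pow]
      simpa using this
    · filter_upwards [Ioo_mem_nhdsLT (zero_lt_one (α := ℝ))] with ρ hρ n
      rw [norm_mul, norm_pow, norm_mul, norm_fourier_apply, mul_one, Complex.norm_real,
        Real.norm_of_nonneg hρ.1.le]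
      exact mul_le_of_le_one_right (norm_nonneg _) (pow_le_one₀ hρ.1.le hρ.2.le)
  refine le_of_tendsto hlim.norm ?_
  filter_upwards [Ioo_mem_nhdsLT (zero_lt_one (α := ℝ))] with ρ hρ
  refine hf _ ?_
  rw [norm_mul, norm_fourier_apply, mul_one, Complex.norm_real, Real.norm_of_nonneg hρ.1.le]
  exact hρ.2

end Circle

section Extremal

open Filter Topology InnerProductSpace

theorem exists_normalised_coeff {r c : ℝ} {f : ℂ → ℂ} {a : ℕ → ℂ} {C : ℝ}
    (h : ∀ z : ℂ, ‖z‖ < 1 → HasSum (fun n : ℕ => a n * z ^ n) (f z))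
    (hf : ∀ z : ℂ, ‖z‖ < 1 → ‖f z‖ ≤ C) (hc : c * C < ∑' n : ℕ, ‖a n‖ * r ^ n) :
    ∃ b : ℕ → ℂ, (∀ n, ‖b n‖ ≤ 1) ∧ (∀ z : ℂ, ‖z‖ < 1 → ‖∑' n, b n * z ^ n‖ ≤ 1) ∧
      c < ∑' n : ℕ, ‖b n‖ * r ^ n := by
  have hcoeff := norm_coeff_le_of_bounded h hf
  have hC : 0 < C := by
    refine ((norm_nonneg _).trans (hcoeff 0)).lt_of_ne fun h0 => ?_
    have ha : ∀ n, ‖a n‖ = 0 := fun n => le_antisymm (h0 ▸ hcoeff n) (norm_nonneg _)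
    simp [ha, ← h0] at hc
  have hnorm : ∀ n, ‖a n / C‖ = C⁻¹ * ‖a n‖ := fun n => by
    rw [norm_div, Complex.norm_real, Real.norm_of_nonneg hC.le, div_eq_inv_mul]
  refine ⟨fun n => a n / C, fun n => ?_, fun z hz => ?_, ?_⟩
  · rw [hnorm, inv_mul_le_one₀ hC]
    exact hcoeff n
  · simp only [div_mul_eq_mul_div]
    rw [((h z hz).div_const (C : ℂ)).tsum_eq, norm_div, Complex.norm_real,
      Real.norm_of_nonneg hC.le, div_le_one hC]
    exact hf z hz
  · simp only [hnorm, mul_assoc]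
    rwa [tsum_mul_left, lt_inv_mul_iff₀ hC, mul_comm]

/-- The supremum of the majorant series over the unit ball of bounded power series is attained. -/
theorem exists_extremal {r m : ℝ} (h0 : 0 ≤ r) (h1 : r < 1)
    (H : ∀ c < m, ∃ (f : ℂ → ℂ) (a : ℕ → ℂ) (C : ℝ),
      (∀ z : ℂ, ‖z‖ < 1 → HasSum (fun n : ℕ => a n * z ^ n) (f z)) ∧
      (∀ z : ℂ, ‖z‖ < 1 → ‖f z‖ ≤ C) ∧ c * C < ∑' n : ℕ, ‖a n‖ * r ^ n) :
    ∃ a : ℕ → ℂ, (∀ n, ‖a n‖ ≤ 1) ∧ (∀ z : ℂ, ‖z‖ < 1 → ‖∑' n, a n * z ^ n‖ ≤ 1) ∧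
      m ≤ ∑' n : ℕ, ‖a n‖ * r ^ n := by
  have hb : ∀ j : ℕ, ∃ b : ℕ → ℂ, (∀ n, ‖b n‖ ≤ 1) ∧
      (∀ z : ℂ, ‖z‖ < 1 → ‖∑' n, b n * z ^ n‖ ≤ 1) ∧
      m - 1 / ((j : ℝ) + 1) < ∑' n : ℕ, ‖b n‖ * r ^ n := by
    intro j
    obtain ⟨f, a, C, ha, hf, hc⟩ := H (m - 1 / ((j : ℝ) + 1)) (sub_lt_self _ (by positivity))
    exact exists_normalised_coeff ha hf hc
  choose b hb1 hbz hbm using hb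
  have hK : IsCompact (Set.univ.pi fun _ : ℕ => Metric.closedBall (0 : ℂ) 1) :=
    isCompact_univ_pi fun _ => isCompact_closedBall 0 1
  obtain ⟨a, ha, φ, hφ, hlim⟩ := hK.tendsto_subseq (x := b) fun j n _ => by
    simpa using hb1 j n
  have hlim' : ∀ n, Tendsto (fun j => b (φ j) n) atTop (𝓝 (a n)) := tendsto_pi_nhds.1 hlim
  refine ⟨a, fun n => by simpa using ha n trivial, fun z hz => ?_, ?_⟩
  · refine le_of_tendsto' (x := atTop) (f := fun j => ‖∑' n, b (φ j) n * z ^ n‖) ?_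
      fun j => hbz (φ j) z hz
    refine (tendsto_tsum_of_dominated_convergence
      (summable_geometric_of_lt_one (norm_nonneg z) hz) (fun n => (hlim' n).mul_const _)
      (Eventually.of_forall fun j n => ?_)).norm
    rw [norm_mul, norm_pow]
    exact mul_le_of_le_one_left (by positivity) (hb1 _ n)
  · have hM : Tendsto (fun j => ∑' n, ‖b (φ j) n‖ * r ^ n) atTop (𝓝 (∑' n, ‖a n‖ * r ^ n)) := by
      refine tendsto_tsum_of_dominated_convergence (summable_geometric_of_lt_one h0 h1)
        (fun n => (hlim' n).norm.mul_const _) (Eventually.of_forall fun j n => ?_)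
      rw [norm_mul, norm_norm, norm_pow, Real.norm_of_nonneg h0]
      exact mul_le_of_le_one_left (by positivity) (hb1 _ n)
    have hm : Tendsto (fun j => m - 1 / ((φ j : ℝ) + 1)) atTop (𝓝 (m - 0)) :=
      tendsto_const_nhds.sub (tendsto_one_div_add_atTop_nhds_zero_nat.comp hφ.tendsto_atTop)
    rw [sub_zero] at hm
    exact le_of_tendsto_of_tendsto' hm hM fun j => (hbm (φ j)).le

/-- Equality in the Cauchy–Schwarz bound for the majorant series forces geometric moduli. -/
theorem norm_eq_of_extremal {a : ℕ → ℂ} {q r s : ℝ} (hr : r ^ 2 = q) (h0 : 0 ≤ r) (h1 : r < 1)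
    (hs : 0 < s) (hsq : s ^ 2 = 1 - q) (ha : ∀ N, ∑ n ∈ Finset.range N, ‖a n‖ ^ 2 ≤ 1)
    (hm : 1 / s ≤ ∑' n : ℕ, ‖a n‖ * r ^ n) (n : ℕ) : ‖a n‖ = s * r ^ n := by
  have hA : Summable fun n => ‖a n‖ ^ 2 :=
    summable_of_sum_range_le (fun n => by positivity) ha
  have hA1 : ∑' n, ‖a n‖ ^ 2 ≤ 1 := hA.tsum_le_of_sum_range_le ha
  have hq : q < 1 := by nlinarith
  have hG : HasSum (fun n => q ^ n) (1 - q)⁻¹ :=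
    hasSum_geometric_of_lt_one (hr ▸ sq_nonneg r) hq
  have hM : Summable fun n => ‖a n‖ * r ^ n := by
    refine Summable.of_nonneg_of_le (fun n => by positivity) (fun n => ?_) (hA.add hG.summable)
    rw [← hr, ← pow_mul, mul_comm 2 n, pow_mul]
    nlinarith [two_mul_le_add_sq ‖a n‖ (r ^ n), sq_nonneg ‖a n‖, sq_nonneg (r ^ n)]
  have hD : HasSum (fun n => (‖a n‖ - s * r ^ n) ^ 2)
      (∑' n, ‖a n‖ ^ 2 - 2 * s * ∑' n, ‖a n‖ * r ^ n + s ^ 2 * (1 - q)⁻¹) := by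
    refine (congrArg (HasSum · _) (funext fun n => ?_)).mpr
      ((hA.hasSum.sub (hM.hasSum.mul_left (2 * s))).add (hG.mul_left (s ^ 2)))
    rw [← hr, ← pow_mul, mul_comm 2 n, pow_mul]
    ring
  have hle : ∑' n, ‖a n‖ ^ 2 - 2 * s * ∑' n, ‖a n‖ * r ^ n + s ^ 2 * (1 - q)⁻¹ ≤ 0 := by
    rw [hsq, mul_inv_cancel₀ (by linarith)]
    rw [div_le_iff₀ hs] at hm
    linarith
  have hz : HasSum (fun n => (‖a n‖ - s * r ^ n) ^ 2) 0 := by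
    rwa [le_antisymm hle (hD.nonneg fun n => sq_nonneg _)] at hD
  have := congrFun ((hasSum_zero_iff_of_nonneg fun n => sq_nonneg _).1 hz) n
  exact sub_eq_zero.1 (pow_eq_zero_iff two_ne_zero |>.1 this)

/-- No power series bounded by one attains the Cauchy–Schwarz bound when `1/2 < r²`. -/
theorem majorant_lt_of_bounded {a : ℕ → ℂ} {r : ℝ} (h0 : 0 < r) (hr : 1 / 2 < r ^ 2) (h1 : r < 1)
    (ha : ∀ n, ‖a n‖ ≤ 1) (hf : ∀ z : ℂ, ‖z‖ < 1 → ‖∑' n, a n * z ^ n‖ ≤ 1) :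
    ∑' n : ℕ, ‖a n‖ * r ^ n < 1 / Real.sqrt (1 - r ^ 2) := by
  by_contra! hm
  have hq : r ^ 2 < 1 := by nlinarith
  have hsq : Real.sqrt (1 - r ^ 2) ^ 2 = 1 - r ^ 2 := Real.sq_sqrt (by linarith)
  have hs : 0 < Real.sqrt (1 - r ^ 2) := Real.sqrt_pos.2 (by linarith)
  have hsum : ∀ N, ∑ n ∈ Finset.range N, ‖a n‖ ^ 2 ≤ 1 := fun N => by
    simpa using sum_norm_sq_le_of_bounded (C := 1)
      (fun z hz => (summable_of_norm_le_one ha hz).hasSum) hf N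
  have hnorm := norm_eq_of_extremal rfl h0.le h1 hs hsq hsum hm
  have hnorm2 : ∀ n, ‖a n‖ ^ 2 = (1 - r ^ 2) * (r ^ 2) ^ n := fun n => by
    rw [hnorm, mul_pow, hsq, ← pow_mul, ← pow_mul, mul_comm n]
  have hsa : Summable fun n => ‖a n‖ := by
    simp only [hnorm]
    exact (summable_geometric_of_lt_one h0.le h1).mul_left _
  have hsum2 : HasSum (fun n => ‖a n‖ ^ 2) 1 := by
    simp only [hnorm2]
    have := (hasSum_geometric_of_lt_one (sq_nonneg r) hq).mul_left (1 - r ^ 2)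
    rwa [mul_inv_cancel₀ (by linarith)] at this
  have hone := (hasSum_norm_sq_boundaryValue hsa).unique hsum2
  obtain ⟨y, hy⟩ := exists_coord_eq hsum2.summable
  refine false_of_geometric_autocorrelation (a := y) hr hq (fun n => by rw [hy, hnorm2])
    fun k => ?_
  have hk := hasSum_autocorrelation hsa (k + 1)
  rw [integral_norm_sq_mul_fourier_eq_zero hsa (norm_boundaryValue_le hsa hf) hone
    (by omega)] at hk
  refine (hasSum_coord_inner y (tailSeq y (k + 1))).unique ?_
  simp only [coord_tailSeq, hy]
  simpa only [mul_comm, add_comm] using hk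

end Extremal

/-- Bombieri–Bourgain: for `1/√2 < r < 1` the Bohr majorant constant satisfies
`m(r) < 1/√(1 - r²)`; i.e. there is a constant `c < 1/√(1 - r²)` with
`∑ |aₙ| rⁿ ≤ c · C` for every analytic `f = ∑ aₙ zⁿ` on the unit disk bounded by `C`. -/
theorem bombieri_bourgain_bound (r : ℝ) (h1 : 1 / Real.sqrt 2 < r) (h2 : r < 1) :
    ∃ c : ℝ, c < 1 / Real.sqrt (1 - r ^ 2) ∧
      ∀ (f : ℂ → ℂ) (a : ℕ → ℂ) (C : ℝ),
        (∀ z : ℂ, ‖z‖ < 1 → HasSum (fun n : ℕ => a n * z ^ n) (f z)) →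
        (∀ z : ℂ, ‖z‖ < 1 → ‖f z‖ ≤ C) →
        ∑' n : ℕ, ‖a n‖ * r ^ n ≤ c * C := by
  have h0 : 0 < r := lt_trans (by positivity) h1
  have hr : 1 / 2 < r ^ 2 := by
    have := pow_lt_pow_left₀ h1 (by positivity) two_ne_zero
    rwa [div_pow, one_pow, Real.sq_sqrt zero_le_two] at this
  by_contra! H
  obtain ⟨a, ha, hf, hm⟩ := exists_extremal h0.le h2 H
  exact (majorant_lt_of_bounded h0 hr h2 ha hf).not_ge hm
end

section
/- Let n ≥ 1 be an integer. If f(z) = Σ_{k=0}^∞ a_{nk} z^{nk} is analytic in the open unit disk 𝔻 with Re f(z) ≤ 1 for all z ∈ 𝔻 and f(0) = a_0 a positive real number, then M_f(r) = Σ_{k=0}^∞ |a_{nk}| r^{nk} ≤ 1 for all 0 ≤ r ≤ 3^{−1/n}. -/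
open Complex in
/-- The integral of a nontrivial character `θ ↦ exp (i m θ)` over a full period. -/
theorem integral_exp_int_mul_I (m : ℤ) :
    ∫ θ in (0 : ℝ)..(2 * Real.pi), exp (m * I * θ) = if m = 0 then (2 * Real.pi : ℂ) else 0 := by
  split_ifs with h
  · simp [h]
  · have hc : (m * I : ℂ) ≠ 0 := mul_ne_zero (by exact_mod_cast h) I_ne_zero
    rw [integral_exp_mul_complex hc]
    have : exp (m * I * ((2 * Real.pi : ℝ) : ℂ)) = 1 := by
      rw [← exp_int_mul_two_pi_mul_I m]
      congr 1
      push_cast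
      ring
    rw [this]
    simp

open Complex in
/-- Fourier coefficients of a power series on a circle inside the disk of convergence. -/
theorem hasSum_integral_powerSeries_mul_exp {g : ℂ → ℂ} {a : ℕ → ℂ}
    (hg : ∀ z : ℂ, ‖z‖ < 1 → HasSum (fun k : ℕ => a k * z ^ k) (g z))
    {ρ : ℝ} (hρ0 : 0 ≤ ρ) (hρ1 : ρ < 1) (m : ℤ) :
    HasSum (fun j : ℕ => if (j : ℤ) + m = 0 then 2 * Real.pi * (a j * ρ ^ j) else 0)
      (∫ θ in (0 : ℝ)..(2 * Real.pi), g (ρ * exp (I * θ)) * exp (m * I * θ)) := by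
  have hnorm (θ : ℝ) : ‖(ρ * exp (I * θ) : ℂ)‖ = ρ := by
    rw [norm_mul, mul_comm I, norm_exp_ofReal_mul_I, mul_one, norm_real, Real.norm_of_nonneg hρ0]
  have hsum : Summable fun j : ℕ => ‖a j‖ * ρ ^ j := by
    have h := (hg ρ (by rwa [norm_real, Real.norm_of_nonneg hρ0])).summable.norm
    simpa [Real.norm_of_nonneg hρ0, abs_of_nonneg hρ0] using h
  have hexp (θ : ℝ) : ‖exp (m * I * θ)‖ = 1 := by
    have : (m * I * θ : ℂ) = ((m * θ : ℝ) : ℂ) * I := by push_cast; ring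
    rw [this, norm_exp_ofReal_mul_I]
  have key := intervalIntegral.hasSum_integral_of_dominated_convergence
    (μ := MeasureTheory.volume) (a := 0) (b := 2 * Real.pi)
    (F := fun (j : ℕ) (θ : ℝ) => a j * (ρ * exp (I * θ)) ^ j * exp (m * I * θ))
    (f := fun θ : ℝ => g (ρ * exp (I * θ)) * exp (m * I * θ))
    (fun j _ => ‖a j‖ * ρ ^ j)
    (fun j => (by fun_prop : Continuous fun θ : ℝ =>
      a j * (ρ * exp (I * θ)) ^ j * exp (m * I * θ)).aestronglyMeasurable)
    (fun j => .of_forall fun θ _ => by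
      rw [norm_mul, norm_mul, norm_pow, hnorm, hexp, mul_one])
    (.of_forall fun _ _ => hsum)
    intervalIntegrable_const
    (.of_forall fun θ _ => (hg _ ((hnorm θ).trans_lt hρ1)).mul_right _)
  have hterm (j : ℕ) (θ : ℝ) : a j * (ρ * exp (I * θ)) ^ j * exp (m * I * θ)
      = a j * ρ ^ j * exp (((j + m : ℤ) : ℂ) * I * θ) := by
    rw [mul_pow, ← exp_nat_mul, ← mul_assoc, mul_assoc, ← exp_add]
    congr 2
    push_cast
    ring
  simp_rw [hterm, intervalIntegral.integral_const_mul, integral_exp_int_mul_I, mul_ite,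
    mul_zero, mul_comm _ (2 * Real.pi : ℂ)] at key
  exact key

open Complex in
/-- A power series on the unit disk is continuous on each circle inside the disk. -/
theorem continuous_powerSeries_circle {g : ℂ → ℂ} {a : ℕ → ℂ}
    (hg : ∀ z : ℂ, ‖z‖ < 1 → HasSum (fun k : ℕ => a k * z ^ k) (g z))
    {ρ : ℝ} (hρ0 : 0 ≤ ρ) (hρ1 : ρ < 1) :
    Continuous fun θ : ℝ => g (ρ * exp (I * θ)) := by
  have hnorm (θ : ℝ) : ‖(ρ * exp (I * θ) : ℂ)‖ = ρ := by
    rw [norm_mul, mul_comm I, norm_exp_ofReal_mul_I, mul_one, norm_real, Real.norm_of_nonneg hρ0]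
  have hsum : Summable fun j : ℕ => ‖a j‖ * ρ ^ j := by
    have h := (hg ρ (by rwa [norm_real, Real.norm_of_nonneg hρ0])).summable.norm
    simpa [Real.norm_of_nonneg hρ0, abs_of_nonneg hρ0] using h
  have hcont : Continuous fun θ : ℝ => ∑' j : ℕ, a j * (ρ * exp (I * θ)) ^ j :=
    continuous_tsum (fun j => by fun_prop) hsum fun j θ => by
      rw [norm_mul, norm_pow, hnorm]
  exact hcont.congr fun θ => (hg _ ((hnorm θ).trans_lt hρ1)).tsum_eq

open Complex in
/-- Carathéodory's coefficient inequality on a circle of radius `ρ < 1`. -/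
theorem norm_coeff_mul_pow_le_of_re_le_one {g : ℂ → ℂ} {a : ℕ → ℂ}
    (hg : ∀ z : ℂ, ‖z‖ < 1 → HasSum (fun k : ℕ => a k * z ^ k) (g z))
    (hre : ∀ z : ℂ, ‖z‖ < 1 → (g z).re ≤ 1) {k : ℕ} (hk : k ≠ 0)
    {ρ : ℝ} (hρ0 : 0 ≤ ρ) (hρ1 : ρ < 1) :
    ‖a k‖ * ρ ^ k ≤ 2 * (1 - (a 0).re) := by
  set G : ℝ → ℂ := fun θ => g (ρ * exp (I * θ))
  have hGc : Continuous G := continuous_powerSeries_circle hg hρ0 hρ1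
  have hnorm (θ : ℝ) : ‖(ρ * exp (I * θ) : ℂ)‖ = ρ := by
    rw [norm_mul, mul_comm I, norm_exp_ofReal_mul_I, mul_one, norm_real, Real.norm_of_nonneg hρ0]
  have hGre (θ : ℝ) : (G θ).re ≤ 1 := hre _ ((hnorm θ).trans_lt hρ1)
  have hneg : ∫ θ in (0 : ℝ)..(2 * Real.pi), G θ * exp ((-k : ℤ) * I * θ)
      = 2 * Real.pi * (a k * ρ ^ k) := by
    refine (hasSum_integral_powerSeries_mul_exp hg hρ0 hρ1 (-k)).unique ?_
    convert hasSum_ite_eq k (2 * Real.pi * (a k * ρ ^ k) : ℂ) using 2 with j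
    by_cases hj : j = k
    · simp [hj]
    · rw [if_neg hj, if_neg (by omega)]
  have hpos : ∫ θ in (0 : ℝ)..(2 * Real.pi), G θ * exp ((k : ℤ) * I * θ) = 0 := by
    refine (hasSum_integral_powerSeries_mul_exp hg hρ0 hρ1 k).unique ?_
    convert (hasSum_zero : HasSum (fun _ : ℕ => (0 : ℂ)) 0) using 2 with j
    rw [if_neg (by omega)]
  have hzero : ∫ θ in (0 : ℝ)..(2 * Real.pi), G θ = 2 * Real.pi * a 0 := by
    have h := hasSum_integral_powerSeries_mul_exp hg hρ0 hρ1 0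
    simp only [Int.cast_zero, zero_mul, exp_zero, mul_one, add_zero] at h
    refine h.unique ?_
    convert hasSum_ite_eq 0 (2 * Real.pi * a 0 : ℂ) using 2 with j
    by_cases hj : j = 0 <;> simp [hj]
  have hchar : ∫ θ in (0 : ℝ)..(2 * Real.pi), exp ((-k : ℤ) * I * θ) = 0 := by
    rw [integral_exp_int_mul_I, if_neg (by omega)]
  have hposconj : ∫ θ in (0 : ℝ)..(2 * Real.pi),
      (starRingEnd ℂ) (G θ) * exp ((-k : ℤ) * I * θ) = 0 := by
    have h := congrArg (starRingEnd ℂ) hpos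
    rw [map_zero] at h
    rw [← h, ← conjCLE_apply, ← ContinuousLinearEquiv.coe_coe,
      ← ContinuousLinearMap.intervalIntegral_comp_comm _
        (Continuous.intervalIntegrable (by fun_prop) _ _)]
    refine intervalIntegral.integral_congr fun θ _ => ?_
    simp [← exp_conj]
  have hint : ∫ θ in (0 : ℝ)..(2 * Real.pi),
      ((2 * (1 - (G θ).re) : ℝ) : ℂ) * exp ((-k : ℤ) * I * θ)
        = -(2 * Real.pi * (a k * ρ ^ k)) := by
    have hsplit (θ : ℝ) : ((2 * (1 - (G θ).re) : ℝ) : ℂ) * exp ((-k : ℤ) * I * θ)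
        = 2 * exp ((-k : ℤ) * I * θ) - G θ * exp ((-k : ℤ) * I * θ)
          - (starRingEnd ℂ) (G θ) * exp ((-k : ℤ) * I * θ) := by
      have h := add_conj (G θ)
      push_cast at h ⊢
      linear_combination exp (-(k : ℂ) * I * θ) * h
    have hconj : Continuous fun θ => (starRingEnd ℂ) (G θ) := continuous_conj.comp hGc
    simp_rw [hsplit]
    rw [intervalIntegral.integral_sub, intervalIntegral.integral_sub,
      intervalIntegral.integral_const_mul, hchar, hneg, hposconj]
    · ring
    all_goals exact Continuous.intervalIntegrable (by fun_prop) _ _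
  have hreal : ∫ θ in (0 : ℝ)..(2 * Real.pi), 2 * (1 - (G θ).re)
      = 2 * Real.pi * (2 * (1 - (a 0).re)) := by
    have hre0 : ∫ θ in (0 : ℝ)..(2 * Real.pi), (G θ).re = 2 * Real.pi * (a 0).re := by
      have h := reCLM.intervalIntegral_comp_comm
        (hGc.intervalIntegrable (μ := MeasureTheory.volume) 0 (2 * Real.pi))
      rw [hzero] at h
      simpa using h
    have hGr : Continuous fun θ => (G θ).re := continuous_re.comp hGc
    rw [intervalIntegral.integral_const_mul, intervalIntegral.integral_sub
      intervalIntegrable_const (hGr.intervalIntegrable _ _), hre0]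
    simp
    ring
  have hle := intervalIntegral.norm_integral_le_integral_norm (μ := MeasureTheory.volume)
    (f := fun θ : ℝ => ((2 * (1 - (G θ).re) : ℝ) : ℂ) * exp ((-k : ℤ) * I * θ))
    Real.two_pi_pos.le
  have hnormint (θ : ℝ) : ‖((2 * (1 - (G θ).re) : ℝ) : ℂ) * exp ((-k : ℤ) * I * θ)‖
      = 2 * (1 - (G θ).re) := by
    have h : ((-k : ℤ) * I * θ : ℂ) = ((-k * θ : ℝ) : ℂ) * I := by push_cast; ring
    rw [norm_mul, h, norm_exp_ofReal_mul_I, mul_one, norm_real, Real.norm_of_nonneg]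
    linarith [hGre θ]
  simp_rw [hnormint] at hle
  rw [hint, hreal, norm_neg, norm_mul, norm_mul (a k), norm_pow, norm_real,
    Real.norm_of_nonneg hρ0] at hle
  have h2pi : ‖(2 * Real.pi : ℂ)‖ = 2 * Real.pi := by
    rw [norm_mul, norm_real, Real.norm_of_nonneg Real.pi_pos.le, norm_ofNat]
  rw [h2pi] at hle
  exact le_of_mul_le_mul_left hle Real.two_pi_pos

/-- Carathéodory's coefficient inequality for power series on the unit disk with real part at
most `1`. -/
theorem norm_coeff_le_of_re_le_one {g : ℂ → ℂ} {a : ℕ → ℂ}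
    (hg : ∀ z : ℂ, ‖z‖ < 1 → HasSum (fun k : ℕ => a k * z ^ k) (g z))
    (hre : ∀ z : ℂ, ‖z‖ < 1 → (g z).re ≤ 1) {k : ℕ} (hk : k ≠ 0) :
    ‖a k‖ ≤ 2 * (1 - (a 0).re) := by
  have hcont : Continuous fun ρ : ℝ => ‖a k‖ * ρ ^ k := by fun_prop
  have hlim : Filter.Tendsto (fun ρ : ℝ => ‖a k‖ * ρ ^ k) (nhdsWithin 1 (Set.Iio 1))
      (nhds ‖a k‖) := by
    simpa using (hcont.tendsto 1).mono_left (nhdsWithin_le_nhds (s := Set.Iio 1))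
  refine le_of_tendsto hlim ?_
  filter_upwards [Ioo_mem_nhdsLT (zero_lt_one' ℝ)] with ρ hρ
  exact norm_coeff_mul_pow_le_of_re_le_one hg hre hk hρ.1.le hρ.2

/-- Bohr inequality for `n`-symmetric functions with real part at most `1`:
if `f z = ∑_k a_{nk} z^{nk}` is analytic in the unit disk with `Re f ≤ 1` and
`f 0 = a₀` a positive real number, then `∑_k |a_{nk}| r^{nk} ≤ 1` for
`0 ≤ r ≤ 3^{-1/n}`. Here `a k` denotes the coefficient of `z^{n k}`. -/
theorem bohr_n_symmetric_re_bounded (n : ℕ) (hn : 1 ≤ n)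
    (f : ℂ → ℂ) (a : ℕ → ℂ)
    (hrep : ∀ z : ℂ, ‖z‖ < 1 → HasSum (fun k : ℕ => a k * z ^ (n * k)) (f z))
    (hre : ∀ z : ℂ, ‖z‖ < 1 → (f z).re ≤ 1)
    (ha0_real : (a 0).im = 0) (ha0_pos : 0 < (a 0).re) :
    ∀ r : ℝ, 0 ≤ r → r ≤ (3 : ℝ) ^ (-(1 : ℝ) / n) →
      ∑' k : ℕ, ‖a k‖ * r ^ (n * k) ≤ 1 := by
  intro r hr0 hr
  have hn0 : n ≠ 0 := by omega
  have hroot (w : ℂ) : ∃ z : ℂ, z ^ n = w := IsAlgClosed.exists_pow_nat_eq w (by omega)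
  choose s hs using hroot
  have hs1 {w : ℂ} (hw : ‖w‖ < 1) : ‖s w‖ < 1 := by
    rwa [← hs w, norm_pow, pow_lt_one_iff_of_nonneg (norm_nonneg _) hn0] at hw
  have hg (w : ℂ) (hw : ‖w‖ < 1) : HasSum (fun k : ℕ => a k * w ^ k) (f (s w)) := by
    simpa only [pow_mul, hs] using hrep (s w) (hs1 hw)
  have hcoeff {k : ℕ} (hk : k ≠ 0) : ‖a k‖ ≤ 2 * (1 - (a 0).re) :=
    norm_coeff_le_of_re_le_one (g := fun w => f (s w)) hg (fun w hw => hre _ (hs1 hw)) hk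
  have hrn : r ^ n ≤ 1 / 3 := by
    calc r ^ n ≤ ((3 : ℝ) ^ (-(1 : ℝ) / n)) ^ n := pow_le_pow_left₀ hr0 hr n
      _ = 1 / 3 := by
        rw [← Real.rpow_mul_natCast (by norm_num), div_mul_cancel₀ _ (by exact_mod_cast hn0),
          Real.rpow_neg_one]
        norm_num
  have hterm (k : ℕ) : ‖a (k + 1)‖ * r ^ (n * (k + 1))
      ≤ 2 * (1 - (a 0).re) * (1 / 3) * (1 / 3) ^ k := by
    rw [pow_mul, mul_assoc, ← pow_succ']
    exact mul_le_mul (hcoeff k.succ_ne_zero) (pow_le_pow_left₀ (by positivity) hrn _)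
      (by positivity) ((norm_nonneg _).trans (hcoeff k.succ_ne_zero))
  have hgeom : HasSum (fun k : ℕ => 2 * (1 - (a 0).re) * (1 / 3) * (1 / 3 : ℝ) ^ k)
      (1 - (a 0).re) := by
    have h := (hasSum_geometric_of_lt_one (r := (1 / 3 : ℝ)) (by norm_num)
      (by norm_num)).mul_left (2 * (1 - (a 0).re) * (1 / 3))
    rwa [show 2 * (1 - (a 0).re) * (1 / 3) * (1 - 1 / 3)⁻¹ = 1 - (a 0).re by
      norm_num; ring] at h
  have hsucc : Summable fun k : ℕ => ‖a (k + 1)‖ * r ^ (n * (k + 1)) :=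
    .of_nonneg_of_le (fun k => by positivity) hterm hgeom.summable
  have hsum : Summable fun k : ℕ => ‖a k‖ * r ^ (n * k) :=
    (summable_nat_add_iff (f := fun k : ℕ => ‖a k‖ * r ^ (n * k)) 1).mp hsucc
  have htail := hsucc.tsum_le_tsum hterm hgeom.summable
  rw [hgeom.tsum_eq] at htail
  have hnorm0 : ‖a 0‖ = (a 0).re := by
    rw [← Complex.abs_re_eq_norm.mpr ha0_real, abs_of_pos ha0_pos]
  rw [hsum.tsum_eq_zero_add, mul_zero, pow_zero, mul_one, hnorm0]
  linarith
end

section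
/- Let n ≥ 1 be an integer. If f(z) = Σ_{k=0}^∞ a_{nk} z^{nk} is analytic in the open unit disk 𝔻 with |f(z)| ≤ 1 for all z ∈ 𝔻, then |a_0|² + Σ_{k=1}^∞ |a_{nk}| r^{nk} ≤ 1 for all 0 ≤ r ≤ 2^{−1/n}. The radius 2^{−1/n} is best possible: for every r with 2^{−1/n} < r < 1 there exists such an f for which the inequality fails. -/
open Complex MeasureTheory Filter Topology

theorem intervalIntegral_exp_int_mul_I (m : ℤ) :
    ∫ θ in (0 : ℝ)..2 * Real.pi, exp (m * θ * I) = if m = 0 then (2 * Real.pi : ℂ) else 0 := by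
  split_ifs with h
  · simp [h]
  · have hc : (m * I : ℂ) ≠ 0 := by simp [h]
    have := integral_exp_mul_complex (a := 0) (b := 2 * Real.pi) hc
    have e : ∀ θ : ℝ, (m * θ * I : ℂ) = m * I * θ := fun θ => by ring
    simp only [e, this]
    have e2 : (m * I * (2 * Real.pi : ℝ) : ℂ) = m * (2 * Real.pi * I) := by push_cast; ring
    rw [e2, exp_int_mul_two_pi_mul_I]
    simp

theorem intervalIntegral_norm_one_add_mul_exp_sq (s : ℂ) {k : ℕ} (hk : k ≠ 0) :
    ∫ θ in (0 : ℝ)..2 * Real.pi, ‖1 + s * exp (k * θ * I)‖ ^ 2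
      = 2 * Real.pi * (1 + ‖s‖ ^ 2) := by
  have e : ∀ θ : ℝ, ‖1 + s * exp (k * θ * I)‖ ^ 2
      = (1 + ‖s‖ ^ 2) + reCLM (2 * (s * exp (k * θ * I))) := fun θ => by
    have h1 : ‖exp (k * θ * I)‖ = 1 := by
      simpa using norm_exp_ofReal_mul_I (k * θ)
    have h2 : ‖s * exp (k * θ * I)‖ ^ 2 = ‖s‖ ^ 2 := by rw [norm_mul, h1, mul_one]
    rw [← h2]
    generalize s * exp (k * θ * I) = w
    simp only [← normSq_eq_norm_sq, normSq_apply, reCLM_apply, add_re, add_im, mul_re, one_re,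
      one_im, re_ofNat, im_ofNat]
    ring
  have hcont : Continuous fun θ : ℝ => 2 * (s * exp (k * θ * I)) := by fun_prop
  have hre : IntervalIntegrable (fun θ : ℝ => reCLM (2 * (s * exp (k * θ * I)))) volume
      0 (2 * Real.pi) := (reCLM.continuous.comp hcont).intervalIntegrable _ _
  have h0 := intervalIntegral_exp_int_mul_I (k : ℤ)
  simp only [Int.cast_natCast, Nat.cast_eq_zero, hk, if_false] at h0
  simp only [e]
  rw [intervalIntegral.integral_add (by simp) hre,
    ContinuousLinearMap.intervalIntegral_comp_comm _ (hcont.intervalIntegrable _ _),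
    intervalIntegral.integral_const_mul, intervalIntegral.integral_const_mul, h0]
  simp
  ring

/-- Testing `g` on the circle of radius `ρ` against the kernel `e^{-ikθ} (1 + s e^{ikθ})²`. -/
theorem norm_two_mul_add_coeff_le {g : ℂ → ℂ} {a : ℕ → ℂ}
    (hg : ∀ z : ℂ, ‖z‖ < 1 → HasSum (fun k : ℕ => a k * z ^ k) (g z))
    (hb : ∀ z : ℂ, ‖z‖ < 1 → ‖g z‖ ≤ 1) {k : ℕ} (hk : k ≠ 0) (s : ℂ) {ρ : ℝ}
    (h0 : 0 ≤ ρ) (h1 : ρ < 1) :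
    ‖2 * s * a 0 + a k * ρ ^ k‖ ≤ 1 + ‖s‖ ^ 2 := by
  have hnorm : ∀ θ : ℝ, ‖(ρ * exp (θ * I) : ℂ)‖ = ρ := fun θ => by
    simp [norm_exp_ofReal_mul_I, abs_of_nonneg h0]
  have hkexp : ∀ θ : ℝ, ‖exp (k * θ * I)‖ = 1 := fun θ => by
    simpa using norm_exp_ofReal_mul_I (k * θ)
  set K : ℝ → ℂ := fun θ => exp (-(k * θ * I)) * (1 + s * exp (k * θ * I)) ^ 2 with hK
  have hKc : Continuous K := by fun_prop
  have hKn : ∀ θ, ‖K θ‖ = ‖1 + s * exp (k * θ * I)‖ ^ 2 := fun θ => by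
    simp only [hK, norm_mul, norm_pow, exp_neg, norm_inv, hkexp]
    simp
  have hsumm : Summable fun j => ‖a j‖ * ρ ^ j := by
    have := (hg (ρ : ℂ) (by simpa [abs_of_nonneg h0] using h1)).summable.norm
    simpa [abs_of_nonneg h0] using this
  set F : ℕ → ℝ → ℂ := fun j θ => a j * (ρ * exp (θ * I)) ^ j * K θ with hF
  have hFc : ∀ j, Continuous (F j) := fun j => by fun_prop
  have hterm : ∀ j, ∫ θ in (0 : ℝ)..2 * Real.pi, F j θ
      = 2 * Real.pi * ((if j = 0 then 2 * s * a 0 else 0) + (if j = k then a k * ρ ^ k else 0)) := by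
    intro j
    have e : ∀ θ, F j θ = a j * ρ ^ j * exp (((j : ℤ) - k : ℤ) * θ * I)
        + a j * ρ ^ j * (2 * s) * exp ((j : ℤ) * θ * I)
        + a j * ρ ^ j * s ^ 2 * exp (((j : ℤ) + k : ℤ) * θ * I) := fun θ => by
      have e1 : exp (((j : ℤ) - k : ℤ) * θ * I) = exp (θ * I) ^ j * exp (-(k * θ * I)) := by
        rw [← exp_nat_mul, ← exp_add]; congr 1; push_cast; ring
      have e2 : exp ((j : ℤ) * θ * I) = exp (θ * I) ^ j := by
        rw [← exp_nat_mul]; congr 1; push_cast; ring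
      have e3 : exp (((j : ℤ) + k : ℤ) * θ * I) = exp (θ * I) ^ j * exp (k * θ * I) := by
        rw [← exp_nat_mul, ← exp_add]; congr 1; push_cast; ring
      have e4 : exp (-(k * θ * I)) * exp (k * θ * I) = 1 := by
        rw [← exp_add]; simp
      rw [e1, e2, e3]
      simp only [hF, hK]
      linear_combination (a j * ρ ^ j * exp (θ * I) ^ j * (2 * s + s ^ 2 * exp (k * θ * I))) * e4
    have hi : ∀ (c : ℂ) (m : ℤ), IntervalIntegrable (fun θ : ℝ => c * exp (m * θ * I)) volume
        0 (2 * Real.pi) := fun c m => Continuous.intervalIntegrable (by fun_prop) _ _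
    simp only [e]
    rw [intervalIntegral.integral_add ((hi _ _).add (hi _ _)) (hi _ _),
      intervalIntegral.integral_add (hi _ _) (hi _ _)]
    simp only [intervalIntegral.integral_const_mul, intervalIntegral_exp_int_mul_I]
    have c1 : ((j : ℤ) - k = 0) ↔ j = k := by omega
    have c3 : ¬ ((j : ℤ) + k = 0) := by omega
    simp only [c1, c3, Nat.cast_eq_zero, if_false]
    by_cases hj : j = 0
    · subst hj
      simp [hk.symm]; ring
    · by_cases hjk : j = k
      · subst hjk; simp [hk]; ring
      · simp [hj, hjk]
  have hsum : HasSum (fun j => ∫ θ in (0 : ℝ)..2 * Real.pi, F j θ)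
      (∫ θ in (0 : ℝ)..2 * Real.pi, g (ρ * exp (θ * I)) * K θ) := by
    refine intervalIntegral.hasSum_integral_of_dominated_convergence
      (fun j θ => ‖a j‖ * ρ ^ j * ‖K θ‖) (fun j => (hFc j).aestronglyMeasurable) ?_ ?_ ?_ ?_
    · intro j
      filter_upwards with θ _
      simp only [hF, norm_mul, norm_pow]
      rw [← norm_mul, hnorm]
    · filter_upwards with θ _ using hsumm.mul_right _
    · simp only [tsum_mul_right]
      exact Continuous.intervalIntegrable (by fun_prop) _ _
    · filter_upwards with θ _
      exact (hg _ (by rw [hnorm]; exact h1)).mul_right _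
  have hval : HasSum (fun j => ∫ θ in (0 : ℝ)..2 * Real.pi, F j θ)
      (2 * Real.pi * (2 * s * a 0 + a k * ρ ^ k)) := by
    simp only [hterm]
    exact ((hasSum_ite_eq 0 _).add (hasSum_ite_eq k _)).mul_left _
  have hbound : ‖(2 * Real.pi * (2 * s * a 0 + a k * ρ ^ k) : ℂ)‖
      ≤ 2 * Real.pi * (1 + ‖s‖ ^ 2) := by
    rw [hval.unique hsum, ← intervalIntegral_norm_one_add_mul_exp_sq s hk]
    refine intervalIntegral.norm_integral_le_of_norm_le Real.two_pi_pos.le ?_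
      (Continuous.intervalIntegrable (by fun_prop) _ _)
    filter_upwards with θ _
    rw [norm_mul, hKn]
    exact mul_le_of_le_one_left (by positivity) (hb _ (by rw [hnorm]; exact h1))
  rw [norm_mul, norm_mul, norm_real, Real.norm_of_nonneg Real.pi_pos.le, norm_ofNat] at hbound
  exact le_of_mul_le_mul_left hbound Real.two_pi_pos

/-- Wiener's coefficient inequality for bounded power series on the unit disk. -/
theorem norm_coeff_le_one_sub_norm_sq {g : ℂ → ℂ} {a : ℕ → ℂ}
    (hg : ∀ z : ℂ, ‖z‖ < 1 → HasSum (fun k : ℕ => a k * z ^ k) (g z))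
    (hb : ∀ z : ℂ, ‖z‖ < 1 → ‖g z‖ ≤ 1) {k : ℕ} (hk : k ≠ 0) :
    ‖a k‖ ≤ 1 - ‖a 0‖ ^ 2 := by
  obtain ⟨u, hu, huk⟩ : ∃ u : ℂ, ‖u‖ = 1 ∧ a k = ‖a k‖ * u :=
    ⟨exp (arg (a k) * I), norm_exp_ofReal_mul_I _, (norm_mul_exp_arg_mul_I _).symm⟩
  set s : ℂ := (starRingEnd ℂ) (a 0) * u with hs
  have hsn : ‖s‖ = ‖a 0‖ := by simp [hs, hu]
  have hs0 : s * a 0 = (‖a 0‖ ^ 2 : ℝ) * u := by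
    rw [hs, mul_right_comm, conj_mul']; push_cast; rfl
  have hρ : ∀ ρ : ℝ, 0 ≤ ρ → ρ < 1 → ‖a k‖ * ρ ^ k ≤ 1 - ‖a 0‖ ^ 2 := by
    intro ρ h0 h1
    have h := norm_two_mul_add_coeff_le hg hb hk s h0 h1
    have e : 2 * s * a 0 + a k * ρ ^ k = ((2 * ‖a 0‖ ^ 2 + ‖a k‖ * ρ ^ k : ℝ) : ℂ) * u := by
      rw [mul_assoc, hs0]
      nth_rw 1 [huk]
      push_cast; ring
    rw [e, norm_mul, hu, norm_real, Real.norm_of_nonneg (by positivity), hsn] at h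
    linarith
  have ht : Tendsto (fun ρ : ℝ => ‖a k‖ * ρ ^ k) (𝓝[<] 1) (𝓝 (‖a k‖)) := by
    have hc : Continuous fun ρ : ℝ => ‖a k‖ * ρ ^ k := by fun_prop
    simpa using (hc.tendsto 1).mono_left nhdsWithin_le_nhds
  refine le_of_tendsto ht ?_
  filter_upwards [Ioo_mem_nhdsLT (zero_lt_one' ℝ)] with ρ h using hρ ρ h.1.le h.2

theorem norm_sub_le_norm_one_sub_mul {c : ℝ} (h0 : 0 ≤ c) (h1 : c ≤ 1) {w : ℂ} (hw : ‖w‖ ≤ 1) :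
    ‖(c - w : ℂ)‖ ≤ ‖(1 - c * w : ℂ)‖ := by
  refine le_of_sq_le_sq ?_ (norm_nonneg _)
  have hw2 : w.re * w.re + w.im * w.im ≤ 1 := by
    rw [← normSq_apply, normSq_eq_norm_sq]
    exact pow_le_one₀ (norm_nonneg _) hw
  simp only [← normSq_eq_norm_sq, normSq_apply, sub_re, sub_im, mul_re, mul_im, ofReal_re,
    ofReal_im, one_re, one_im]
  have : 0 ≤ (1 - c ^ 2) * (1 - (w.re * w.re + w.im * w.im)) :=
    mul_nonneg (by nlinarith) (by linarith)
  nlinarith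

/-- Taylor coefficients of the Möbius map `w ↦ (c - w) / (1 - c w)`. -/
noncomputable def mobiusCoeff (c : ℝ) : ℕ → ℂ
  | 0 => c
  | k + 1 => -((1 - c ^ 2) * c ^ k)

theorem hasSum_mobiusCoeff {c : ℝ} (h0 : 0 ≤ c) (h1 : c < 1) {w : ℂ} (hw : ‖w‖ < 1) :
    HasSum (fun k => mobiusCoeff c k * w ^ k) ((c - w) / (1 - c * w)) := by
  have hcw : ‖(c * w : ℂ)‖ < 1 := by
    rw [norm_mul, norm_real, Real.norm_of_nonneg h0]
    nlinarith [norm_nonneg w]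
  have hne : (1 - c * w : ℂ) ≠ 0 := fun h => by
    rw [← sub_eq_zero.mp h] at hcw
    simp at hcw
  have h := (hasSum_geometric_of_norm_lt_one hcw).mul_left (-((1 - c ^ 2) * w) : ℂ)
  have hterm : (fun k => mobiusCoeff c (k + 1) * w ^ (k + 1))
      = fun k => -((1 - c ^ 2) * w) * (c * w) ^ k := by
    funext k
    simp only [mobiusCoeff]
    ring
  have hval : (c - w) / (1 - c * w) - ∑ i ∈ Finset.range 1, mobiusCoeff c i * w ^ i
      = -((1 - c ^ 2) * w) * (1 - c * w)⁻¹ := by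
    simp only [Finset.range_one, Finset.sum_singleton, mobiusCoeff, pow_zero]
    field_simp
    ring
  rw [← hasSum_nat_add_iff' 1, hterm, hval]
  exact h

theorem tsum_norm_mobiusCoeff {c x : ℝ} (h0 : 0 ≤ c) (h1 : c < 1) (hx0 : 0 ≤ x) (hx1 : x < 1) :
    ∑' k, ‖mobiusCoeff c (k + 1)‖ * x ^ (k + 1) = (1 - c ^ 2) * x / (1 - c * x) := by
  have hc2 : 0 ≤ 1 - c ^ 2 := by nlinarith
  have e : ∀ k, ‖mobiusCoeff c (k + 1)‖ * x ^ (k + 1) = (1 - c ^ 2) * x * (c * x) ^ k := by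
    intro k
    have : mobiusCoeff c (k + 1) = ((-((1 - c ^ 2) * c ^ k) : ℝ) : ℂ) := by
      simp [mobiusCoeff]
    rw [this, norm_real, norm_neg, Real.norm_of_nonneg (by positivity)]
    ring
  simp only [e]
  rw [tsum_mul_left, tsum_geometric_of_lt_one (by positivity) (by nlinarith), div_eq_mul_inv]

theorem two_rpow_neg_one_div_pow {n : ℕ} (hn : n ≠ 0) :
    ((2 : ℝ) ^ (-(1 : ℝ) / n)) ^ n = 1 / 2 := by
  rw [← Real.rpow_natCast, ← Real.rpow_mul (by norm_num),
    div_mul_cancel₀ _ (Nat.cast_ne_zero.mpr hn), Real.rpow_neg_one, one_div]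

/-- Improved Bohr inequality for `n`-symmetric functions, with the constant
term squared: if `f z = ∑_k a_{nk} z^{nk}` is analytic in the unit disk with
`|f| ≤ 1`, then `|a₀|² + ∑_{k≥1} |a_{nk}| r^{nk} ≤ 1` for `0 ≤ r ≤ 2^{-1/n}`,
and the radius `2^{-1/n}` is best possible.
Here `a k` denotes the coefficient of `z^{n k}`. -/
theorem bohr_n_symmetric_squared_constant (n : ℕ) (hn : 1 ≤ n) :
    (∀ (f : ℂ → ℂ) (a : ℕ → ℂ),
      (∀ z : ℂ, ‖z‖ < 1 → HasSum (fun k : ℕ => a k * z ^ (n * k)) (f z)) →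
      (∀ z : ℂ, ‖z‖ < 1 → ‖f z‖ ≤ 1) →
      ∀ r : ℝ, 0 ≤ r → r ≤ (2 : ℝ) ^ (-(1 : ℝ) / n) →
        ‖a 0‖ ^ 2 + ∑' k : ℕ, ‖a (k + 1)‖ * r ^ (n * (k + 1)) ≤ 1) ∧
    (∀ r : ℝ, (2 : ℝ) ^ (-(1 : ℝ) / n) < r → r < 1 →
      ∃ (f : ℂ → ℂ) (a : ℕ → ℂ),
        (∀ z : ℂ, ‖z‖ < 1 → HasSum (fun k : ℕ => a k * z ^ (n * k)) (f z)) ∧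
        (∀ z : ℂ, ‖z‖ < 1 → ‖f z‖ ≤ 1) ∧
        1 < ‖a 0‖ ^ 2 + ∑' k : ℕ, ‖a (k + 1)‖ * r ^ (n * (k + 1))) := by
  have hn0 : n ≠ 0 := by omega
  have hpow := two_rpow_neg_one_div_pow hn0
  constructor
  · intro f a hf hb r hr0 hr
    have hx0 : 0 ≤ r ^ n := by positivity
    have hx : r ^ n ≤ 1 / 2 := hpow ▸ pow_le_pow_left₀ hr0 hr n
    choose ψ hψ using fun w : ℂ => IsAlgClosed.exists_pow_nat_eq w hn
    have hψn : ∀ w : ℂ, ‖w‖ < 1 → ‖ψ w‖ < 1 := fun w hw => by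
      rw [← pow_lt_one_iff_of_nonneg (norm_nonneg _) hn0, ← norm_pow, hψ]
      exact hw
    have hcoeff : ∀ k, ‖a (k + 1)‖ ≤ 1 - ‖a 0‖ ^ 2 := fun k => by
      refine norm_coeff_le_one_sub_norm_sq (g := fun w => f (ψ w)) (fun w hw => ?_)
        (fun w hw => hb _ (hψn w hw)) k.succ_ne_zero
      simpa only [pow_mul, hψ] using hf _ (hψn w hw)
    have hgeo := (hasSum_geometric_of_lt_one hx0 (by linarith)).mul_left
      ((1 - ‖a 0‖ ^ 2) * r ^ n)
    have hle : ∀ k, ‖a (k + 1)‖ * r ^ (n * (k + 1))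
        ≤ (1 - ‖a 0‖ ^ 2) * r ^ n * (r ^ n) ^ k := fun k => by
      rw [pow_mul, pow_succ', ← mul_assoc]
      have := hcoeff k
      gcongr
    have hsum : ∑' k, ‖a (k + 1)‖ * r ^ (n * (k + 1))
        ≤ (1 - ‖a 0‖ ^ 2) * r ^ n * (1 - r ^ n)⁻¹ := by
      rw [← hgeo.tsum_eq]
      exact (Summable.of_nonneg_of_le (fun k => by positivity) hle hgeo.summable).tsum_le_tsum
        hle hgeo.summable
    have hq : r ^ n * (1 - r ^ n)⁻¹ ≤ 1 := by
      rw [← div_eq_mul_inv, div_le_one (by linarith)]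
      linarith
    have h0 : 0 ≤ 1 - ‖a 0‖ ^ 2 := (norm_nonneg _).trans (hcoeff 0)
    rw [mul_assoc] at hsum
    linarith [mul_le_of_le_one_right h0 hq]
  · intro r hr hr1
    have hr0 : 0 ≤ r := (Real.rpow_nonneg zero_le_two _).trans hr.le
    have hx : 1 / 2 < r ^ n := hpow ▸ pow_lt_pow_left₀ hr (by positivity) hn0
    have hx1 : r ^ n < 1 := pow_lt_one₀ hr0 hr1 hn0
    have hzn : ∀ z : ℂ, ‖z‖ < 1 → ‖z ^ n‖ < 1 := fun z hz => by
      rw [norm_pow]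
      exact pow_lt_one₀ (norm_nonneg _) hz hn0
    generalize hxr : r ^ n = x at hx hx1
    have hxpos : 0 < x := by linarith
    obtain ⟨c, hc0, hc1, hcx⟩ : ∃ c : ℝ, 0 ≤ c ∧ c < 1 ∧ c * x = 1 / 2 :=
      ⟨1 / 2 / x, by positivity, (div_lt_one hxpos).mpr hx, div_mul_cancel₀ _ hxpos.ne'⟩
    refine ⟨fun z => (c - z ^ n) / (1 - c * z ^ n), mobiusCoeff c, fun z hz => ?_,
      fun z hz => ?_, ?_⟩
    · simpa only [pow_mul] using hasSum_mobiusCoeff hc0 hc1 (hzn z hz)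
    · rw [norm_div]
      exact div_le_one_of_le₀ (norm_sub_le_norm_one_sub_mul hc0 hc1.le (hzn z hz).le)
        (norm_nonneg _)
    · have ha0 : ‖mobiusCoeff c 0‖ = c := by simp [mobiusCoeff, abs_of_nonneg hc0]
      simp only [pow_mul, hxr]
      rw [tsum_norm_mobiusCoeff hc0 hc1 hxpos.le hx1, ha0, hcx]
      have hc2 : 0 < 1 - c ^ 2 := by nlinarith
      have : (1 - c ^ 2) * x / (1 - 1 / 2) = (1 - c ^ 2) * (2 * x) := by ring
      rw [this]
      nlinarith [mul_pos hc2 (show 0 < 2 * x - 1 by linarith)]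
end

section
/- Let f(z) = h(z) + conj(g(z)) = Σ_{n=0}^∞ a_n z^n + conj(Σ_{n=1}^∞ b_n z^n) be a complex-valued harmonic function in the open unit disk 𝔻, where h and g are analytic in 𝔻. If |f(z)| < 1 for all z ∈ 𝔻, then Σ_{n=1}^∞ (|a_n| + |b_n|) r^n ≤ 2/π for all 0 ≤ r ≤ 1/3. -/
open ComplexConjugate

theorem integral_abs_cos_nat_mul_add (n : ℕ) (hn : n ≠ 0) (γ : ℝ) :
    ∫ t in (0 : ℝ)..2 * Real.pi, |Real.cos (n * t + γ)| = 4 := by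
  have hper : Function.Periodic (fun t : ℝ => |Real.cos t|) Real.pi := fun t => by
    simp [Real.cos_add_pi]
  have hbase : ∫ t in (-(Real.pi / 2))..(-(Real.pi / 2) + Real.pi), |Real.cos t| = 2 := by
    have : ∫ t in (-(Real.pi / 2))..(-(Real.pi / 2) + Real.pi), |Real.cos t|
        = ∫ t in (-(Real.pi / 2))..(-(Real.pi / 2) + Real.pi), Real.cos t := by
      refine intervalIntegral.integral_congr fun t ht => ?_
      rw [Set.uIcc_of_le (by linarith [Real.pi_pos])] at ht
      exact abs_of_nonneg (Real.cos_nonneg_of_mem_Icc ⟨ht.1, by linarith [ht.2]⟩)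
    rw [this, integral_cos, show -(Real.pi / 2) + Real.pi = Real.pi / 2 by ring]
    simp; norm_num
  have hn' : (n : ℝ) ≠ 0 := by exact_mod_cast hn
  rw [intervalIntegral.integral_comp_mul_add (fun t => |Real.cos t|) hn' γ]
  have h1 := hper.intervalIntegral_add_zsmul_eq (2 * n) γ
    (fun a b => (Real.continuous_cos.abs).intervalIntegrable a b)
  have h2 := hper.intervalIntegral_add_eq 0 (-(Real.pi / 2))
  rw [zero_add] at h2
  have h3 : (n : ℝ) * (2 * Real.pi) + γ = γ + (2 * n : ℤ) • Real.pi := by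
    simp; ring
  rw [mul_zero, zero_add, h3, h1, hper.intervalIntegral_add_eq γ (-(Real.pi / 2)), hbase]
  simp; field_simp; norm_num

theorem integral_exp_int_mul_I_s11 (k : ℤ) :
    ∫ t in (0 : ℝ)..2 * Real.pi, Complex.exp (k * (t * Complex.I)) =
      if k = 0 then 2 * (Real.pi : ℂ) else 0 := by
  split_ifs with hk
  · simp [hk]
  · have hc : (k : ℂ) * Complex.I ≠ 0 := mul_ne_zero (by exact_mod_cast hk) Complex.I_ne_zero
    have := integral_exp_mul_complex (a := 0) (b := 2 * Real.pi) hc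
    have e : Complex.exp ((k : ℂ) * Complex.I * (2 * Real.pi : ℝ)) = 1 := by
      rw [Complex.exp_eq_one_iff]; exact ⟨k, by push_cast; ring⟩
    rw [e] at this
    simpa [mul_assoc, mul_comm Complex.I] using this

theorem continuous_of_hasSum_exp {c : ℕ → ℂ} {H : ℝ → ℂ} (hc : Summable fun m => ‖c m‖)
    (hH : ∀ t : ℝ, HasSum (fun m : ℕ => c m * Complex.exp (m * (t * Complex.I))) (H t)) :
    Continuous H := by
  have : H = fun t : ℝ => ∑' m : ℕ, c m * Complex.exp (m * (t * Complex.I)) :=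
    funext fun t => (hH t).tsum_eq.symm
  rw [this]
  refine continuous_tsum (fun m => by fun_prop) hc fun m t => ?_
  rw [norm_mul, ← mul_assoc]
  have := Complex.norm_exp_ofReal_mul_I (m * t)
  push_cast at this
  rw [this, mul_one]

/-- Termwise integration of an absolutely convergent Fourier series against `exp (j t I)`. -/
theorem integral_mul_exp_of_hasSum {c : ℕ → ℂ} {H : ℝ → ℂ} (hc : Summable fun m => ‖c m‖)
    (hH : ∀ t : ℝ, HasSum (fun m : ℕ => c m * Complex.exp (m * (t * Complex.I))) (H t))
    (j : ℤ) :
    HasSum (fun m : ℕ => c m * if (m : ℤ) + j = 0 then 2 * (Real.pi : ℂ) else 0)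
      (∫ t in (0 : ℝ)..2 * Real.pi, H t * Complex.exp (j * (t * Complex.I))) := by
  have key : ∀ m : ℕ, ∫ t in (0 : ℝ)..2 * Real.pi,
      c m * Complex.exp (m * (t * Complex.I)) * Complex.exp (j * (t * Complex.I)) =
      c m * if (m : ℤ) + j = 0 then 2 * (Real.pi : ℂ) else 0 := fun m => by
    rw [← integral_exp_int_mul_I_s11, ← intervalIntegral.integral_const_mul]
    refine intervalIntegral.integral_congr fun t _ => ?_
    simp only [mul_assoc, ← Complex.exp_add]
    push_cast
    ring_nf
  simp_rw [← key]
  have hn : ∀ (k : ℤ) (t : ℝ), ‖Complex.exp (k * (t * Complex.I))‖ = 1 := fun k t => by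
    rw [← mul_assoc]
    exact_mod_cast Complex.norm_exp_ofReal_mul_I (k * t)
  refine intervalIntegral.hasSum_integral_of_dominated_convergence (fun m _ => ‖c m‖)
    (fun m => ?_) (fun m => ?_) ?_ ?_ ?_
  · exact Continuous.aestronglyMeasurable (by fun_prop)
  · refine Filter.Eventually.of_forall fun t _ => ?_
    have := hn m t
    push_cast at this
    rw [norm_mul, norm_mul, hn, this, mul_one, mul_one]
  · exact Filter.Eventually.of_forall fun t _ => hc
  · simp
  · exact Filter.Eventually.of_forall fun t _ => (hH t).mul_right _

/-- If `H + conj G` is bounded by `1`, where `H` and `G` have absolutely convergent Fourier series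
with nonnegative frequencies, then the `n`-th coefficients satisfy `‖c n‖ + ‖d n‖ ≤ 4 / π`. -/
theorem norm_coeff_add_norm_coeff_le {c d : ℕ → ℂ} {H G : ℝ → ℂ}
    (hc : Summable fun m => ‖c m‖) (hd : Summable fun m => ‖d m‖)
    (hH : ∀ t : ℝ, HasSum (fun m : ℕ => c m * Complex.exp (m * (t * Complex.I))) (H t))
    (hG : ∀ t : ℝ, HasSum (fun m : ℕ => d m * Complex.exp (m * (t * Complex.I))) (G t))
    (hHG : ∀ t, ‖H t + conj (G t)‖ ≤ 1) {n : ℕ} (hn : n ≠ 0) :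
    ‖c n‖ + ‖d n‖ ≤ 4 / Real.pi := by
  have contH := continuous_of_hasSum_exp hc hH
  have contG := continuous_of_hasSum_exp hd hG
  have contG' : Continuous fun t => conj (G t) := Complex.continuous_conj.comp contG
  have neg_coeff : ∀ {c : ℕ → ℂ} {H : ℝ → ℂ}, (Summable fun m => ‖c m‖) →
      (∀ t : ℝ, HasSum (fun m : ℕ => c m * Complex.exp (m * (t * Complex.I))) (H t)) →
      ∫ t in (0 : ℝ)..2 * Real.pi, H t * Complex.exp ((-n : ℤ) * (t * Complex.I)) =
        c n * (2 * Real.pi) := fun {c H} hc hH => by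
    refine (integral_mul_exp_of_hasSum hc hH (-n)).unique ?_
    convert hasSum_single n fun m hm => ?_ using 1
    · simp
    · rw [if_neg (by omega), mul_zero]
  have pos_coeff : ∀ {c : ℕ → ℂ} {H : ℝ → ℂ}, (Summable fun m => ‖c m‖) →
      (∀ t : ℝ, HasSum (fun m : ℕ => c m * Complex.exp (m * (t * Complex.I))) (H t)) →
      ∫ t in (0 : ℝ)..2 * Real.pi, H t * Complex.exp ((n : ℤ) * (t * Complex.I)) = 0 :=
    fun {c H} hc hH => by
    refine (integral_mul_exp_of_hasSum hc hH n).unique ?_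
    convert hasSum_zero using 2 with m
    rw [if_neg (by omega), mul_zero]
  have conj_int : ∀ k : ℤ,
      ∫ t in (0 : ℝ)..2 * Real.pi, conj (G t) * Complex.exp (k * (t * Complex.I)) =
      conj (∫ t in (0 : ℝ)..2 * Real.pi, G t * Complex.exp ((-k : ℤ) * (t * Complex.I))) :=
    fun k => by
    rw [← intervalIntegral.intervalIntegral_conj]
    refine intervalIntegral.integral_congr fun t _ => ?_
    simp [← Complex.exp_conj]
  have hneg : ∫ t in (0 : ℝ)..2 * Real.pi,
      (H t + conj (G t)) * Complex.exp ((-n : ℤ) * (t * Complex.I)) = c n * (2 * Real.pi) := by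
    simp_rw [add_mul]
    rw [intervalIntegral.integral_add (Continuous.intervalIntegrable (by fun_prop) _ _)
      (Continuous.intervalIntegrable (by fun_prop) _ _), neg_coeff hc hH, conj_int, neg_neg,
      pos_coeff hd hG, map_zero, add_zero]
  have hpos : ∫ t in (0 : ℝ)..2 * Real.pi,
      (H t + conj (G t)) * Complex.exp ((n : ℤ) * (t * Complex.I)) =
        conj (d n) * (2 * Real.pi) := by
    simp_rw [add_mul]
    rw [intervalIntegral.integral_add (Continuous.intervalIntegrable (by fun_prop) _ _)
      (Continuous.intervalIntegrable (by fun_prop) _ _), pos_coeff hc hH, conj_int,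
      neg_coeff hd hG, zero_add, map_mul, map_mul, Complex.conj_ofReal, map_ofNat]
  set α := (c n).arg
  set β := (d n).arg
  let K : ℝ → ℂ := fun t =>
    Complex.exp (-(α * Complex.I)) * Complex.exp ((-n : ℤ) * (t * Complex.I)) +
    Complex.exp (β * Complex.I) * Complex.exp ((n : ℤ) * (t * Complex.I))
  have contK : Continuous K := by fun_prop
  have normK : ∀ t : ℝ, ‖K t‖ = 2 * |Real.cos (n * t + (α + β) / 2)| := fun t => by
    have : K t = Complex.exp (((β - α) / 2 : ℝ) * Complex.I) *
        ((2 * Real.cos (n * t + (α + β) / 2) : ℝ) : ℂ) := by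
      push_cast
      rw [Complex.two_cos, mul_add]
      simp only [K, ← Complex.exp_add]
      push_cast
      rw [add_comm]
      congr 2 <;> ring
    rw [this, norm_mul, Complex.norm_exp_ofReal_mul_I, one_mul, Complex.norm_real,
      Real.norm_eq_abs, abs_mul, abs_two]
  have hα : Complex.exp (-(α * Complex.I)) * c n = ‖c n‖ := by
    conv_lhs => rw [← Complex.norm_mul_exp_arg_mul_I (c n)]
    rw [mul_left_comm, ← Complex.exp_add, neg_add_cancel, Complex.exp_zero, mul_one]
  have hβ : Complex.exp (β * Complex.I) * conj (d n) = ‖d n‖ := by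
    conv_lhs => rw [← Complex.norm_mul_exp_arg_mul_I (d n)]
    rw [map_mul, Complex.conj_ofReal, ← Complex.exp_conj, map_mul, Complex.conj_ofReal,
      Complex.conj_I, mul_left_comm, ← Complex.exp_add, mul_neg, add_neg_cancel,
      Complex.exp_zero, mul_one]
  have hint : ∫ t in (0 : ℝ)..2 * Real.pi, (H t + conj (G t)) * K t =
      ((2 * Real.pi * (‖c n‖ + ‖d n‖) : ℝ) : ℂ) := by
    have : ∀ t, (H t + conj (G t)) * K t =
        Complex.exp (-(α * Complex.I)) *
          ((H t + conj (G t)) * Complex.exp ((-n : ℤ) * (t * Complex.I))) +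
        Complex.exp (β * Complex.I) *
          ((H t + conj (G t)) * Complex.exp ((n : ℤ) * (t * Complex.I))) := fun t => by
      simp only [K]; ring
    simp_rw [this]
    rw [intervalIntegral.integral_add (Continuous.intervalIntegrable (by fun_prop) _ _)
      (Continuous.intervalIntegrable (by fun_prop) _ _), intervalIntegral.integral_const_mul,
      intervalIntegral.integral_const_mul, hneg, hpos, ← mul_assoc, hα,
      ← mul_assoc (Complex.exp (β * Complex.I)), hβ]
    push_cast
    ring
  have hle : ‖∫ t in (0 : ℝ)..2 * Real.pi, (H t + conj (G t)) * K t‖ ≤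
      ∫ t in (0 : ℝ)..2 * Real.pi, 2 * |Real.cos (n * t + (α + β) / 2)| := by
    refine intervalIntegral.norm_integral_le_of_norm_le Real.two_pi_pos.le
      (Filter.Eventually.of_forall fun t _ => ?_)
      (Continuous.intervalIntegrable (by fun_prop) _ _)
    rw [norm_mul, normK]
    exact mul_le_of_le_one_left (by positivity) (hHG t)
  rw [hint, intervalIntegral.integral_const_mul, integral_abs_cos_nat_mul_add n hn,
    Complex.norm_real, Real.norm_of_nonneg (by positivity)] at hle
  rw [le_div_iff₀ Real.pi_pos]
  linarith

/-- Bohr-type inequality for bounded harmonic mappings (Abu Muhanna):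
if `f = h + conj g` with `h z = ∑_{n≥0} aₙ zⁿ`, `g z = ∑_{n≥1} bₙ zⁿ` analytic in
the unit disk and `|f| < 1` there, then `∑_{n≥1} (|aₙ| + |bₙ|) rⁿ ≤ 2/π` for
`0 ≤ r ≤ 1/3`. -/
theorem bohr_harmonic_two_over_pi
    (f h g : ℂ → ℂ) (a b : ℕ → ℂ) (hb0 : b 0 = 0)
    (hh : ∀ z : ℂ, ‖z‖ < 1 → HasSum (fun n : ℕ => a n * z ^ n) (h z))
    (hgrep : ∀ z : ℂ, ‖z‖ < 1 → HasSum (fun n : ℕ => b n * z ^ n) (g z))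
    (hf : ∀ z : ℂ, ‖z‖ < 1 → f z = h z + conj (g z))
    (hbound : ∀ z : ℂ, ‖z‖ < 1 → ‖f z‖ < 1) :
    ∀ r : ℝ, 0 ≤ r → r ≤ 1 / 3 →
      ∑' n : ℕ, (‖a (n + 1)‖ + ‖b (n + 1)‖) * r ^ (n + 1) ≤ 2 / Real.pi := by
  have scaled : ∀ n : ℕ, n ≠ 0 → ∀ ρ ∈ Set.Ioo (0 : ℝ) 1,
      (‖a n‖ + ‖b n‖) * ρ ^ n ≤ 4 / Real.pi := fun n hn ρ hρ => by
    have hρ' : ‖(ρ : ℂ)‖ < 1 := by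
      rw [Complex.norm_real, Real.norm_of_nonneg hρ.1.le]; exact hρ.2
    have hz : ∀ t : ℝ, ‖(ρ : ℂ) * Complex.exp (t * Complex.I)‖ < 1 := fun t => by
      rwa [norm_mul, Complex.norm_exp_ofReal_mul_I, mul_one]
    have hpow : ∀ {e : ℕ → ℂ} {k : ℂ → ℂ},
        (∀ z : ℂ, ‖z‖ < 1 → HasSum (fun n : ℕ => e n * z ^ n) (k z)) → ∀ t : ℝ,
        HasSum (fun m : ℕ => e m * (ρ : ℂ) ^ m * Complex.exp (m * (t * Complex.I)))
          (k (ρ * Complex.exp (t * Complex.I))) := fun hk t => by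
      simpa only [mul_pow, ← Complex.exp_nat_mul, mul_assoc] using hk _ (hz t)
    have := norm_coeff_add_norm_coeff_le (hh _ hρ').summable.norm (hgrep _ hρ').summable.norm
      (hpow hh) (hpow hgrep) (fun t => by rw [← hf _ (hz t)]; exact (hbound _ (hz t)).le) hn
    simpa [add_mul, abs_of_pos hρ.1] using this
  have coeff : ∀ n : ℕ, n ≠ 0 → ‖a n‖ + ‖b n‖ ≤ 4 / Real.pi := fun n hn => by
    have ht : Filter.Tendsto (fun ρ : ℝ => (‖a n‖ + ‖b n‖) * ρ ^ n) (nhdsWithin 1 (Set.Iio 1))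
        (nhds ((‖a n‖ + ‖b n‖) * 1 ^ n)) :=
      (Continuous.tendsto (by fun_prop) 1).mono_left nhdsWithin_le_nhds
    rw [one_pow, mul_one] at ht
    exact le_of_tendsto ht
      (Filter.mem_of_superset (Ioo_mem_nhdsLT one_pos) fun ρ hρ => scaled n hn ρ hρ)
  intro r hr0 hr
  have hgeom : HasSum (fun n : ℕ => 4 / Real.pi * r ^ (n + 1)) (4 / Real.pi * r * (1 - r)⁻¹) := by
    simpa only [pow_succ', mul_assoc] using
      (hasSum_geometric_of_lt_one hr0 (by linarith)).mul_left (4 / Real.pi * r)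
  have hterm : ∀ n : ℕ, (‖a (n + 1)‖ + ‖b (n + 1)‖) * r ^ (n + 1) ≤ 4 / Real.pi * r ^ (n + 1) :=
    fun n => mul_le_mul_of_nonneg_right (coeff _ n.succ_ne_zero) (by positivity)
  have hsum := hgeom.summable.of_nonneg_of_le (fun n => by positivity) hterm
  refine (hsum.tsum_le_tsum hterm hgeom.summable).trans ?_
  have h1r : 0 < 1 - r := by linarith
  have hfrac : r * (1 - r)⁻¹ ≤ 1 / 2 := by
    rw [← div_eq_mul_inv, div_le_iff₀ h1r]
    linarith
  calc _ = 4 / Real.pi * (r * (1 - r)⁻¹) := by rw [hgeom.tsum_eq, mul_assoc]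
    _ ≤ 4 / Real.pi * (1 / 2) := mul_le_mul_of_nonneg_left hfrac (by positivity)
    _ = 2 / Real.pi := by ring
end

section
/- Let f(z) = h(z) + conj(g(z)) = Σ_{n=0}^∞ a_n z^n + conj(Σ_{n=1}^∞ b_n z^n) be a complex-valued harmonic function in the open unit disk 𝔻, where h and g are analytic in 𝔻. If |f(z)| < 1 for all z ∈ 𝔻, then for every real μ and all 0 ≤ r ≤ 1/3, Σ_{n=1}^∞ |e^{iμ} a_n + e^{−iμ} b_n| r^n + |Re(e^{iμ} a_0)| ≤ 1. -/
open ComplexConjugate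

section Caratheodory

open Complex Metric Real

variable {p : ℕ → ℂ} {P : ℂ → ℂ}

lemma mem_eball_zero_one_iff {z : ℂ} : z ∈ eball (0 : ℂ) 1 ↔ ‖z‖ < 1 := by
  rw [← ENNReal.coe_one, eball_coe, mem_ball_zero_iff, NNReal.coe_one]

/-- A function given on the unit disk by a convergent scalar power series has that power series
as its expansion on the unit ball. -/
lemma hasFPowerSeriesOnBall_ofScalars_of_hasSum
    (hP : ∀ z : ℂ, ‖z‖ < 1 → HasSum (fun n : ℕ => p n * z ^ n) (P z)) :
    HasFPowerSeriesOnBall P (FormalMultilinearSeries.ofScalars ℂ p) 0 1 where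
  r_le := by
    refine ENNReal.le_of_forall_nnreal_lt fun r hr => ?_
    have hr' : ‖((r : ℝ) : ℂ)‖ < 1 := by simpa using hr
    refine FormalMultilinearSeries.le_radius_of_tendsto (l := 0) _ ?_
    simpa using (hP _ hr').summable.norm.tendsto_atTop_zero
  r_pos := one_pos
  hasSum := by
    intro y hy
    have hy' : ‖y‖ < 1 := mem_eball_zero_one_iff.1 hy
    simpa only [FormalMultilinearSeries.ofScalars_apply_eq, smul_eq_mul, zero_add] using hP y hy'

/-- Cauchy's formula for the coefficients of a power series, as an average over a circle. -/
lemma circleAverage_inv_pow_mul_eq_coeff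
    (hP : ∀ z : ℂ, ‖z‖ < 1 → HasSum (fun n : ℕ => p n * z ^ n) (P z))
    {R : ℝ} (hR0 : 0 < R) (hR1 : R < 1) (n : ℕ) :
    circleAverage (fun z => (1 / z) ^ n * P z) 0 R = p n := by
  have hps := hasFPowerSeriesOnBall_ofScalars_of_hasSum hP
  lift R to NNReal using hR0.le
  have hsub : closedBall (0 : ℂ) R ⊆ eball 0 1 := by
    intro z hz
    have : ‖z‖ < 1 := (by simpa using hz : ‖z‖ ≤ R).trans_lt hR1
    exact mem_eball_zero_one_iff.2 this
  have hd : DifferentiableOn ℂ P (closedBall 0 R) := hps.differentiableOn.mono hsub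
  have heq := (hd.hasFPowerSeriesOnBall (by exact_mod_cast hR0)).hasFPowerSeriesAt
    |>.eq_formalMultilinearSeries hps.hasFPowerSeriesAt
  have h1 := cauchyPowerSeries_apply P 0 R n 1
  rw [heq, FormalMultilinearSeries.ofScalars_apply_eq] at h1
  rw [circleAverage_eq_circleIntegral hR0.ne']
  simp only [one_pow, smul_eq_mul, mul_one] at h1
  rw [h1, smul_eq_mul]
  congr 2
  ext z
  simp only [smul_eq_mul]
  ring

/-- **Carathéodory's coefficient inequality**. -/
theorem norm_coeff_le_two_mul_re_of_re_nonneg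
    (hP : ∀ z : ℂ, ‖z‖ < 1 → HasSum (fun n : ℕ => p n * z ^ n) (P z))
    (hre : ∀ z : ℂ, ‖z‖ < 1 → 0 ≤ (P z).re) {n : ℕ} (hn : n ≠ 0) :
    ‖p n‖ ≤ 2 * (p 0).re := by
  have hps := hasFPowerSeriesOnBall_ofScalars_of_hasSum hP
  have key : ∀ R : ℝ, 0 < R → R < 1 → ‖p n‖ * R ^ n ≤ 2 * (p 0).re := by
    intro R hR0 hR1
    have hR : |R| = R := abs_of_pos hR0
    have hcl : closedBall (0 : ℂ) |R| ⊆ eball 0 1 := by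
      intro z hz
      have : ‖z‖ < 1 := (by simpa [hR] using hz : ‖z‖ ≤ R).trans_lt hR1
      exact mem_eball_zero_one_iff.2 this
    have hd : DifferentiableOn ℂ P (closedBall 0 |R|) := hps.differentiableOn.mono hcl
    have hc : ContinuousOn P (sphere 0 |R|) := hd.continuousOn.mono sphere_subset_closedBall
    have hne : ∀ z ∈ sphere (0 : ℂ) |R|, z ≠ 0 := by
      rintro z hz rfl
      rw [mem_sphere, dist_self, hR] at hz
      exact hR0.ne hz
    have hci : ContinuousOn (fun z : ℂ => (1 / z) ^ n) (sphere 0 |R|) :=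
      (continuousOn_const.div continuousOn_id hne).pow n
    have hi : ContinuousOn (fun z : ℂ => (1 / z) ^ n * P z) (sphere 0 |R|) := hci.mul hc
    have hi' : ContinuousOn (fun z : ℂ => (1 / z) ^ n * conj (P z)) (sphere 0 |R|) :=
      hci.mul (continuous_conj.comp_continuousOn hc)
    have hnorm : ∀ z ∈ sphere (0 : ℂ) |R|, ‖(1 / z) ^ n‖ = (R ^ n)⁻¹ := by
      intro z hz
      have : ‖z‖ = R := by simpa [hR] using hz
      simp [this]
    have hz0 : circleAverage (fun z => z ^ n * P z) 0 R = 0 := by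
      have : DifferentiableOn ℂ (fun z => z ^ n * P z) (closedBall 0 |R|) := by fun_prop
      rw [DiffContOnCl.circleAverage (this.mono closure_ball_subset_closedBall).diffContOnCl]
      simp [hn]
    have hconj : circleAverage (fun z => (1 / z) ^ n * conj (P z)) 0 R = 0 := by
      have hint : CircleIntegrable (fun z : ℂ => z ^ n * P z) 0 R :=
        ((by fun_prop : ContinuousOn (fun z : ℂ => z ^ n * P z) (sphere 0 |R|))).circleIntegrable'
      have h1 := (conjCLE : ℂ →L[ℝ] ℂ).circleAverage_comp_comm hint
      rw [hz0, map_zero] at h1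
      have h2 : circleAverage (fun z => (1 / z) ^ n * conj (P z)) 0 R =
          circleAverage (fun z => ((R : ℂ) ^ (2 * n))⁻¹ •
            ((conjCLE : ℂ →L[ℝ] ℂ) ∘ fun z : ℂ => z ^ n * P z) z) 0 R := by
        refine circleAverage_congr_sphere fun z hz => ?_
        have hz' : ‖z‖ = R := by simpa [hR] using hz
        have hzz : z * conj z = (R : ℂ) ^ 2 := by rw [mul_conj', hz']
        have hz1 := hne z hz
        have hcz : conj z ≠ 0 := by simpa using hz1
        simp only [Function.comp_apply, smul_eq_mul, pow_mul, ← hzz]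
        simp
        field_simp
        ring
      rw [h2, circleAverage_fun_smul, h1, smul_zero]
    have hmain : p n = circleAverage (fun z => (1 / z) ^ n * ((2 * (P z).re : ℝ) : ℂ)) 0 R := by
      have h := circleAverage_fun_add hi.circleIntegrable' hi'.circleIntegrable'
      rw [circleAverage_inv_pow_mul_eq_coeff hP hR0 hR1, hconj, add_zero] at h
      rw [← h]
      congr 1
      ext z
      rw [← mul_add, add_conj]
    have h0 : circleAverage (fun z => (P z).re) 0 R = (p 0).re := by
      have h1 := reCLM.circleAverage_comp_comm (hc.circleIntegrable')
      have h2 := circleAverage_inv_pow_mul_eq_coeff hP hR0 hR1 0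
      simp only [pow_zero, one_mul] at h2
      rw [← h2]
      exact h1
    have hle : ‖p n‖ ≤ (R ^ n)⁻¹ * 2 * (p 0).re := by
      rw [← h0, hmain, ← smul_eq_mul, ← circleAverage_fun_smul, circleAverage_def,
        circleAverage_def, norm_smul, smul_eq_mul, Real.norm_of_nonneg (by positivity)]
      gcongr
      refine intervalIntegral.norm_integral_le_of_norm_le two_pi_pos.le ?_ ?_
      · refine Filter.Eventually.of_forall fun t _ => ?_
        have hm : circleMap 0 R t ∈ sphere (0 : ℂ) |R| := circleMap_mem_sphere' 0 R t
        have hm' : ‖circleMap 0 R t‖ < 1 := by simpa [hR] using hR1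
        rw [norm_mul, hnorm _ hm, norm_real,
          Real.norm_of_nonneg (by linarith [hre _ hm']), smul_eq_mul, mul_assoc]
      · have : ContinuousOn (fun z => ((R ^ n)⁻¹ * 2) • (P z).re) (sphere 0 |R|) :=
          (continuous_re.comp_continuousOn hc).const_smul ((R ^ n)⁻¹ * 2)
        exact this.circleIntegrable'
    have hRn : 0 < R ^ n := by positivity
    rw [mul_assoc, inv_mul_eq_div, le_div_iff₀ hRn] at hle
    exact hle
  have ht : Filter.Tendsto (fun R : ℝ => ‖p n‖ * R ^ n) (nhdsWithin 1 (Set.Iio 1))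
      (nhds (‖p n‖ * 1 ^ n)) :=
    ((continuous_const.mul (continuous_id.pow n)).tendsto 1).mono_left nhdsWithin_le_nhds
  rw [one_pow, mul_one] at ht
  refine le_of_tendsto ht ?_
  filter_upwards [Ioo_mem_nhdsLT (zero_lt_one' ℝ)] with R hR using key R hR.1 hR.2

/-- The coefficients of a power series whose real part is at most one in absolute value on the
unit disk. -/
theorem norm_coeff_le_of_abs_re_le_one
    (hP : ∀ z : ℂ, ‖z‖ < 1 → HasSum (fun n : ℕ => p n * z ^ n) (P z))
    (hre : ∀ z : ℂ, ‖z‖ < 1 → |(P z).re| ≤ 1) {n : ℕ} (hn : n ≠ 0) :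
    ‖p n‖ ≤ 2 * (1 - |(p 0).re|) := by
  have hone : ∀ z : ℂ, HasSum (fun n : ℕ => (if n = 0 then (1 : ℂ) else 0) * z ^ n) 1 := by
    intro z
    convert hasSum_ite_eq 0 (1 : ℂ) using 2 with n
    split_ifs with h <;> simp [h]
  have hadd := norm_coeff_le_two_mul_re_of_re_nonneg
    (p := fun n => (if n = 0 then (1 : ℂ) else 0) + p n) (P := fun z => 1 + P z)
    (fun z hz => by simpa only [add_mul] using (hone z).add (hP z hz))
    (fun z hz => by
      have := (abs_le.1 (hre z hz)).1
      simp only [add_re, one_re]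
      linarith) hn
  have hsub := norm_coeff_le_two_mul_re_of_re_nonneg
    (p := fun n => (if n = 0 then (1 : ℂ) else 0) - p n) (P := fun z => 1 - P z)
    (fun z hz => by simpa only [sub_mul] using (hone z).sub (hP z hz))
    (fun z hz => by
      have := (abs_le.1 (hre z hz)).2
      simp only [sub_re, one_re]
      linarith) hn
  simp only [hn, if_true, if_false, zero_add, zero_sub, norm_neg, add_re, sub_re, one_re]
    at hadd hsub
  rcases abs_cases (p 0).re with h | h <;> linarith

end Caratheodory

/-- Bohr-type inequality for bounded harmonic mappings (Abu Muhanna):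
if `f = h + conj g` with `h z = ∑_{n≥0} aₙ zⁿ`, `g z = ∑_{n≥1} bₙ zⁿ` analytic in
the unit disk and `|f| < 1` there, then for every real `μ` and `0 ≤ r ≤ 1/3`,
`∑_{n≥1} |e^{iμ} aₙ + e^{-iμ} bₙ| rⁿ + |Re(e^{iμ} a₀)| ≤ 1`. -/
theorem bohr_harmonic_rotated
    (f h g : ℂ → ℂ) (a b : ℕ → ℂ) (hb0 : b 0 = 0)
    (hh : ∀ z : ℂ, ‖z‖ < 1 → HasSum (fun n : ℕ => a n * z ^ n) (h z))
    (hgrep : ∀ z : ℂ, ‖z‖ < 1 → HasSum (fun n : ℕ => b n * z ^ n) (g z))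
    (hf : ∀ z : ℂ, ‖z‖ < 1 → f z = h z + conj (g z))
    (hbound : ∀ z : ℂ, ‖z‖ < 1 → ‖f z‖ < 1) :
    ∀ μ : ℝ, ∀ r : ℝ, 0 ≤ r → r ≤ 1 / 3 →
      (∑' n : ℕ,
          ‖Complex.exp (μ * Complex.I) * a (n + 1) +
            Complex.exp (-(μ * Complex.I)) * b (n + 1)‖ * r ^ (n + 1)) +
        |(Complex.exp (μ * Complex.I) * a 0).re| ≤ 1 := by
  intro μ r hr0 hr1
  set u : ℂ := Complex.exp (μ * Complex.I) with hu
  have hv : Complex.exp (-(μ * Complex.I)) = conj u := by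
    rw [hu, ← Complex.exp_conj]
    simp
  have hun : ‖u‖ = 1 := Complex.norm_exp_ofReal_mul_I μ
  rw [hv]
  have hsum : ∀ z : ℂ, ‖z‖ < 1 →
      HasSum (fun n : ℕ => (u * a n + conj u * b n) * z ^ n) (u * h z + conj u * g z) := by
    intro z hz
    simpa only [add_mul, mul_assoc] using
      ((hh z hz).mul_left u).add ((hgrep z hz).mul_left (conj u))
  have hre : ∀ z : ℂ, ‖z‖ < 1 → |(u * h z + conj u * g z).re| ≤ 1 := by
    intro z hz
    have heq : (u * h z + conj u * g z).re = (u * f z).re := by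
      rw [hf z hz]
      simp
      ring
    rw [heq]
    calc |(u * f z).re| ≤ ‖u * f z‖ := Complex.abs_re_le_norm _
      _ ≤ 1 := by rw [norm_mul, hun, one_mul]; exact (hbound z hz).le
  have hcoeff : ∀ n : ℕ,
      ‖u * a (n + 1) + conj u * b (n + 1)‖ ≤ 2 * (1 - |(u * a 0).re|) := by
    intro n
    simpa [hb0] using norm_coeff_le_of_abs_re_le_one hsum hre n.succ_ne_zero
  set C : ℝ := 1 - |(u * a 0).re| with hC
  have hgeom : HasSum (fun n : ℕ => 2 * C * (1 / 3 : ℝ) ^ (n + 1)) C := by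
    have := (hasSum_geometric_of_lt_one (r := (1 / 3 : ℝ)) (by norm_num) (by norm_num)).mul_left
      (2 * C * (1 / 3))
    rw [show 2 * C * (1 / 3) * (1 - 1 / 3 : ℝ)⁻¹ = C by norm_num; ring] at this
    simpa only [pow_succ', mul_assoc] using this
  have hterm : ∀ n : ℕ, ‖u * a (n + 1) + conj u * b (n + 1)‖ * r ^ (n + 1) ≤
      2 * C * (1 / 3 : ℝ) ^ (n + 1) := fun n =>
    mul_le_mul (hcoeff n) (pow_le_pow_left₀ hr0 hr1 _) (pow_nonneg hr0 _)
      ((norm_nonneg _).trans (hcoeff n))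
  have hsummable := Summable.of_nonneg_of_le
    (fun n => mul_nonneg (norm_nonneg _) (pow_nonneg hr0 _)) hterm hgeom.summable
  have hle := (hsummable.tsum_le_tsum hterm hgeom.summable).trans_eq hgeom.tsum_eq
  linarith
end

section
/- Let f(z) = Σ_{n=0}^∞ a_n z^n be analytic in the open unit disk 𝔻 with |f(z)| > 1 for all z ∈ 𝔻 (i.e., f maps 𝔻 into the exterior of the closed unit disk). Then for all z with |z| ≤ 1/3, χ(Σ_{n=0}^∞ |a_n z^n|, |a_0|) ≤ inf_{|w|=1} χ(a_0, w), where χ is the spherical chordal distance. -/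
/-- The spherical chordal distance on `ℂ`. -/
noncomputable def chordal (z w : ℂ) : ℝ :=
  ‖z - w‖ / (Real.sqrt (1 + ‖z‖ ^ 2) * Real.sqrt (1 + ‖w‖ ^ 2))

open Complex Metric Finset

/-- A zero-free holomorphic function on a disk has a holomorphic logarithm. -/
theorem exists_differentiableOn_exp_eq {f : ℂ → ℂ} {r : ℝ} (hr : 0 < r)
    (hf : DifferentiableOn ℂ f (ball 0 r)) (h0 : ∀ z ∈ ball (0 : ℂ) r, f z ≠ 0) :
    ∃ g : ℂ → ℂ, DifferentiableOn ℂ g (ball 0 r) ∧ ∀ z ∈ ball (0 : ℂ) r, exp (g z) = f z := by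
  obtain ⟨g, hg0, hg⟩ := ((hf.deriv isOpen_ball).div hf h0).isExactOn_ball.with_val_at
    (0 : ℂ) (log (f 0))
  refine ⟨g, fun z hz => (hg z hz).differentiableAt.differentiableWithinAt, fun z hz => ?_⟩
  have hd : ∀ w ∈ ball (0 : ℂ) r, HasDerivAt (fun w => f w * exp (-g w)) 0 w := by
    intro w hw
    have h1 := (hf.differentiableAt (isOpen_ball.mem_nhds hw)).hasDerivAt
    refine (h1.mul (hg w hw).fun_neg.cexp).congr_deriv ?_
    have := h0 w hw
    simp only [Pi.div_apply]
    field_simp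
    ring
  have hc : f z * exp (-g z) = f 0 * exp (-g 0) :=
    isOpen_ball.is_const_of_deriv_eq_zero (convex_ball _ _).isPreconnected
      (fun w hw => (hd w hw).differentiableAt.differentiableWithinAt)
      (fun w hw => (hd w hw).deriv) hz (mem_ball_self hr)
  rw [hg0, exp_neg, exp_neg, exp_log (h0 0 (mem_ball_self hr)),
    mul_inv_cancel₀ (h0 0 (mem_ball_self hr))] at hc
  have := exp_ne_zero (g z)
  field_simp at hc
  exact hc.symm

/-- The Taylor coefficients at the origin, as derivatives, of a power series converging on the
unit disk. -/
theorem differentiableOn_and_iteratedDeriv_of_hasSum {f : ℂ → ℂ} {a : ℕ → ℂ}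
    (h : ∀ z : ℂ, ‖z‖ < 1 → HasSum (fun n : ℕ => a n * z ^ n) (f z)) :
    DifferentiableOn ℂ f (ball 0 1) ∧ ∀ n, iteratedDeriv n f 0 = n.factorial * a n := by
  have hp : HasFPowerSeriesOnBall f (FormalMultilinearSeries.ofScalars ℂ a) 0 1 := by
    refine ⟨?_, one_pos, ?_⟩
    · refine ENNReal.le_of_forall_nnreal_lt fun r hr => ?_
      have hr' : ‖((r : ℝ) : ℂ)‖ < 1 := by simpa using hr
      refine FormalMultilinearSeries.le_radius_of_tendsto _ (l := 0) ?_
      simpa using (h _ hr').summable.tendsto_atTop_zero.norm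
    · intro y hy
      have hy' : ‖y‖ < 1 := by simpa [enorm_eq_nnnorm, ← NNReal.coe_lt_one] using hy
      simpa [FormalMultilinearSeries.ofScalars_apply_eq, mul_comm] using h y hy'
  refine ⟨?_, fun n => ?_⟩
  · have := hp.differentiableOn
    rwa [← ENNReal.coe_one, eball_coe] at this
  · have := hp.factorial_smul 1 n
    rw [iteratedFDeriv_apply_eq_iteratedDeriv_mul_prod] at this
    simpa [FormalMultilinearSeries.ofScalars_apply_eq] using this.symm

/-- If the coefficients `b` satisfy the recursive inequality of `exp (C z / (1 - z))`, then the
partial sums of `∑ bₙ rⁿ` are bounded by `b₀ exp (C r / (1 - r))`. -/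
theorem sum_range_le_mul_exp_of_recursive_le {b : ℕ → ℝ} (hb : ∀ n, 0 ≤ b n) {C : ℝ} (hC : 0 ≤ C)
    (h : ∀ n : ℕ, (n + 1) * b (n + 1) ≤ C * ∑ i ∈ range (n + 1), (i + 1) * b (n - i))
    {r : ℝ} (hr0 : 0 ≤ r) (hr1 : r < 1) (N : ℕ) :
    ∑ n ∈ range (N + 1), b n * r ^ n ≤ b 0 * Real.exp (C * (r / (1 - r))) := by
  set S : ℝ → ℝ := fun t => ∑ n ∈ range (N + 1), b n * t ^ n with hS
  set S' : ℝ → ℝ := fun t => ∑ n ∈ range N, (n + 1) * b (n + 1) * t ^ n with hS'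
  have hSd : ∀ t, HasDerivAt S (S' t) t := by
    intro t
    have := HasDerivAt.fun_sum (u := range (N + 1)) (A := fun n t => b n * t ^ n)
      (A' := fun n => b n * (n * t ^ (n - 1))) (x := t)
      fun n _ => (hasDerivAt_pow n t).const_mul (b n)
    refine this.congr_deriv ?_
    rw [sum_range_succ']
    simp only [hS', Nat.add_sub_cancel]
    push_cast
    simp only [zero_mul, mul_zero, add_zero]
    exact sum_congr rfl fun n _ => by ring
  have hSle : ∀ t, 0 ≤ t → t < 1 → S' t ≤ C * (1 / (1 - t) ^ 2) * S t := by
    intro t ht0 ht1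
    have hS0 : ∀ M, 0 ≤ ∑ j ∈ range M, b j * t ^ j := fun M =>
      sum_nonneg fun j _ => mul_nonneg (hb j) (pow_nonneg ht0 j)
    have hgeo : ∑ i ∈ range N, ((i : ℝ) + 1) * t ^ i ≤ 1 / (1 - t) ^ 2 := by
      have := hasSum_choose_mul_geometric_of_norm_lt_one (𝕜 := ℝ) 1 (r := t)
        (by rwa [Real.norm_of_nonneg ht0])
      simp only [Nat.choose_one_right] at this
      push_cast at this
      exact sum_le_hasSum _ (fun i _ => by positivity) this
    calc S' t ≤ ∑ n ∈ range N, C * ∑ i ∈ range (n + 1),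
            (((i : ℝ) + 1) * t ^ i) * (b (n - i) * t ^ (n - i)) := by
          refine sum_le_sum fun n _ => ?_
          refine (mul_le_mul_of_nonneg_right (h n) (pow_nonneg ht0 n)).trans_eq ?_
          rw [mul_assoc, sum_mul]
          congr 1
          refine sum_congr rfl fun i hi => ?_
          rw [← Nat.add_sub_of_le (Nat.lt_succ_iff.1 (mem_range.1 hi)), pow_add]
          simp only [Nat.add_sub_cancel_left]
          ring
      _ = C * ∑ i ∈ range N, ∑ j ∈ range (N - i), (((i : ℝ) + 1) * t ^ i) * (b j * t ^ j) := by
          rw [← mul_sum, sum_range_diag_flip N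
            fun i j => (((i : ℝ) + 1) * t ^ i) * (b j * t ^ j)]
      _ ≤ C * ∑ i ∈ range N, (((i : ℝ) + 1) * t ^ i) * S t := by
          gcongr with i hi
          rw [← mul_sum]
          gcongr
          refine sum_le_sum_of_subset_of_nonneg (range_mono (by omega)) fun j _ _ =>
            mul_nonneg (hb j) (pow_nonneg ht0 j)
      _ ≤ C * (1 / (1 - t) ^ 2 * S t) := by
          rw [← sum_mul]
          gcongr
          exact hS0 _
      _ = _ := by ring
  have hFd : ∀ t < 1, HasDerivAt (fun t => S t * Real.exp (-(C * (t / (1 - t)))))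
      ((S' t - C * (1 / (1 - t) ^ 2) * S t) * Real.exp (-(C * (t / (1 - t))))) t := by
    intro t ht
    have h1 : (1 - t) ≠ 0 := by linarith
    have h2 : HasDerivAt (fun t : ℝ => t / (1 - t)) (1 / (1 - t) ^ 2) t := by
      refine ((hasDerivAt_id' t).fun_div ((hasDerivAt_id' t).const_sub 1) h1).congr_deriv ?_
      ring
    refine ((hSd t).fun_mul (h2.const_mul C).fun_neg.exp).congr_deriv ?_
    ring
  have hanti : AntitoneOn (fun t => S t * Real.exp (-(C * (t / (1 - t))))) (Set.Icc 0 r) := by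
    refine antitoneOn_of_deriv_nonpos (convex_Icc 0 r) ?_ ?_ ?_
    · exact fun t ht => (hFd t (ht.2.trans_lt hr1)).continuousAt.continuousWithinAt
    · rw [interior_Icc]
      exact fun t ht => (hFd t (ht.2.trans hr1)).differentiableAt.differentiableWithinAt
    · rw [interior_Icc]
      intro t ht
      rw [(hFd t (ht.2.trans hr1)).deriv]
      exact mul_nonpos_of_nonpos_of_nonneg
        (sub_nonpos.2 (hSle t ht.1.le (ht.2.trans hr1))) (Real.exp_pos _).le
  have := hanti ⟨le_rfl, hr0⟩ ⟨hr0, le_rfl⟩ hr0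
  have h00 : S 0 = b 0 := by simp [hS, sum_range_succ']
  simp only [h00, zero_div, mul_zero, neg_zero, Real.exp_zero, mul_one, Real.exp_neg] at this
  exact (mul_inv_le_iff₀ (Real.exp_pos _)).1 this

/-- The Taylor coefficients of `f = exp g` satisfy the recursion given by `f' = g' f`. -/
theorem iteratedDeriv_succ_of_exp_eq {f g : ℂ → ℂ} {r : ℝ} (hr : 0 < r)
    (hf : DifferentiableOn ℂ f (ball 0 r)) (hg : DifferentiableOn ℂ g (ball 0 r))
    (hfg : ∀ z ∈ ball (0 : ℂ) r, exp (g z) = f z) (n : ℕ) :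
    iteratedDeriv (n + 1) f 0 = ∑ i ∈ range (n + 1),
      n.choose i * iteratedDeriv (i + 1) g 0 * iteratedDeriv (n - i) f 0 := by
  have hmem : ball (0 : ℂ) r ∈ nhds 0 := ball_mem_nhds 0 hr
  have he : deriv f =ᶠ[nhds 0] deriv g * f := by
    filter_upwards [hmem] with z hz
    have h1 := (hg.differentiableAt (isOpen_ball.mem_nhds hz)).hasDerivAt.cexp
    have h2 : HasDerivAt f (exp (g z) * deriv g z) z := by
      refine h1.congr_of_eventuallyEq ?_
      filter_upwards [isOpen_ball.mem_nhds hz] with w hw using (hfg w hw).symm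
    rw [h2.deriv, hfg z hz, mul_comm, Pi.mul_apply]
  rw [iteratedDeriv_succ', he.iteratedDeriv_eq n,
    iteratedDeriv_mul ((hg.deriv isOpen_ball).analyticAt hmem).contDiffAt
      (hf.analyticAt hmem).contDiffAt]
  simp only [iteratedDeriv_succ']

/-- **Carathéodory's coefficient bound** for holomorphic functions with nonnegative real part. -/
theorem norm_iteratedDeriv_le_of_re_nonneg {g : ℂ → ℂ} (hg : DifferentiableOn ℂ g (ball 0 1))
    (hre : ∀ z ∈ ball (0 : ℂ) 1, 0 ≤ (g z).re) {n : ℕ} (hn : n ≠ 0) :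
    ‖iteratedDeriv n g 0‖ ≤ n.factorial * (2 * (g 0).re) := by
  have key : ∀ r : ℝ, 0 < r → r < 1 →
      r ^ n * ‖iteratedDeriv n g 0‖ ≤ n.factorial * (2 * (g 0).re) := by
    intro r hr0 hr1
    have hsub : closedBall (0 : ℂ) r ⊆ ball 0 1 := closedBall_subset_ball hr1
    have hgr := hg.mono hsub
    have hgs : ContinuousOn g (sphere 0 r) := hgr.continuousOn.mono sphere_subset_closedBall
    have hz0 : ∀ z ∈ sphere (0 : ℂ) r, z ≠ 0 := fun z hz => ne_of_mem_sphere hz hr0.ne'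
    have hinv : ContinuousOn (fun z : ℂ => (z ^ n)⁻¹) (sphere 0 r) :=
      (continuousOn_pow n).inv₀ fun z hz => pow_ne_zero n (hz0 z hz)
    have h1 : Real.circleAverage (fun z => (z ^ n)⁻¹ * g z) 0 r =
        iteratedDeriv n g 0 / n.factorial := by
      have h := hgr.circleIntegral_one_div_sub_center_pow_smul hr0 n
      rw [Real.circleAverage_eq_circleIntegral hr0.ne']
      have e : (∮ z in C(0, r), (z - 0)⁻¹ • ((z ^ n)⁻¹ * g z)) =
          ∮ z in C(0, r), (1 / (z - 0) ^ (n + 1)) • g z := by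
        refine circleIntegral.integral_congr hr0.le fun z hz => ?_
        have := hz0 z hz
        simp only [sub_zero, smul_eq_mul]
        field_simp
        ring
      rw [e, h]
      have := two_pi_I_ne_zero
      simp only [smul_eq_mul]
      field_simp
    have h2 : Real.circleAverage (fun z => (z ^ n)⁻¹ * (starRingEnd ℂ) (g z)) 0 r = 0 := by
      have h3 : Real.circleAverage (fun z => z ^ n * g z) 0 r = 0 := by
        have hd : DifferentiableOn ℂ (fun z => z ^ n * g z) (closedBall 0 r) := by fun_prop
        have hd' : DiffContOnCl ℂ (fun z => z ^ n * g z) (ball 0 |r|) := by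
          rw [abs_of_pos hr0]
          exact (hd.mono closure_ball_subset_closedBall).diffContOnCl
        simpa [hn] using hd'.circleAverage
      have h4 : Real.circleAverage (fun z => (starRingEnd ℂ) (z ^ n * g z)) 0 r = 0 := by
        have := ContinuousLinearMap.circleAverage_comp_comm (c := 0) (R := r)
          (f := fun z => z ^ n * g z) (conjCLE : ℂ →L[ℝ] ℂ)
          (ContinuousOn.circleIntegrable hr0.le ((continuousOn_pow n).mul hgs))
        rw [h3, map_zero] at this
        exact this
      have h5 : Real.circleAverage (fun z => (z ^ n)⁻¹ * (starRingEnd ℂ) (g z)) 0 r =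
          Real.circleAverage
            (((r ^ (2 * n))⁻¹ : ℝ) • fun z => (starRingEnd ℂ) (z ^ n * g z)) 0 r := by
        refine Real.circleAverage_congr_sphere fun z hz => ?_
        rw [abs_of_pos hr0] at hz
        have hz' := hz0 z hz
        have hzz : z * (starRingEnd ℂ) z = (r : ℂ) ^ 2 := by
          rw [mul_conj, normSq_eq_norm_sq, mem_sphere_zero_iff_norm.1 hz]; push_cast; rfl
        have hr' : (r : ℂ) ≠ 0 := by exact_mod_cast hr0.ne'
        simp only [Pi.smul_apply, real_smul, map_mul, map_pow]
        push_cast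
        rw [pow_mul, ← hzz, mul_pow, mul_inv]
        have : (starRingEnd ℂ) z ≠ 0 := by simpa using hz'
        field_simp
      rw [h5, Real.circleAverage_smul, h4, smul_zero]
    have h6 : iteratedDeriv n g 0 / n.factorial =
        Real.circleAverage (fun z => (z ^ n)⁻¹ * ((2 * (g z).re : ℝ) : ℂ)) 0 r := by
      have hadd := Real.circleAverage_fun_add
        (f₁ := fun z => (z ^ n)⁻¹ * g z) (f₂ := fun z => (z ^ n)⁻¹ * (starRingEnd ℂ) (g z))
        (ContinuousOn.circleIntegrable hr0.le (hinv.mul hgs))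
        (ContinuousOn.circleIntegrable hr0.le
          (hinv.mul (continuous_conj.comp_continuousOn hgs)))
      rw [h2, add_zero, h1] at hadd
      rw [← hadd]
      congr 1
      ext z
      rw [← mul_add, add_conj]
    have h7 : Real.circleAverage (fun z => (g z).re) 0 r = (g 0).re := by
      have hd : DiffContOnCl ℂ g (ball 0 |r|) := by
        rw [abs_of_pos hr0]
        exact (hgr.mono closure_ball_subset_closedBall).diffContOnCl
      have := ContinuousLinearMap.circleAverage_comp_comm (c := 0) (R := r)
          (f := g) reCLM (ContinuousOn.circleIntegrable hr0.le hgs)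
      rw [hd.circleAverage] at this
      exact this
    have h8 : ‖iteratedDeriv n g 0 / n.factorial‖ ≤ (r ^ n)⁻¹ * (2 * (g 0).re) := by
      have e : (r ^ n)⁻¹ * (2 * (g 0).re) =
          Real.circleAverage (((r ^ n)⁻¹ * 2) • fun z => (g z).re) 0 r := by
        rw [Real.circleAverage_smul, h7, smul_eq_mul]; ring
      rw [h6, e, Real.circleAverage_def, Real.circleAverage_def, norm_smul, smul_eq_mul,
        Real.norm_of_nonneg (by positivity)]
      gcongr
      refine (intervalIntegral.norm_integral_le_integral_norm Real.two_pi_pos.le).trans_eq ?_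
      refine intervalIntegral.integral_congr fun θ _ => ?_
      have hm : circleMap 0 r θ ∈ ball (0 : ℂ) 1 := hsub (circleMap_mem_closedBall _ hr0.le θ)
      have := hre _ hm
      simp only [norm_mul, norm_inv, norm_pow, norm_circleMap_zero, abs_of_pos hr0,
        norm_real, Pi.smul_apply, smul_eq_mul]
      rw [Real.norm_of_nonneg zero_le_two, Real.norm_of_nonneg this]
      ring
    have hf : (0 : ℝ) < n.factorial := by positivity
    rw [norm_div, Complex.norm_natCast, div_le_iff₀ hf] at h8
    have hrn : (0 : ℝ) < r ^ n := by positivity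
    calc r ^ n * ‖iteratedDeriv n g 0‖
        ≤ r ^ n * ((r ^ n)⁻¹ * (2 * (g 0).re) * n.factorial) := by gcongr
      _ = _ := by field_simp
  have hlim : Filter.Tendsto (fun r : ℝ => r ^ n * ‖iteratedDeriv n g 0‖)
      (nhdsWithin 1 (Set.Iio 1)) (nhds (1 ^ n * ‖iteratedDeriv n g 0‖)) :=
    ((continuous_pow n).mul continuous_const).continuousWithinAt.tendsto
  rw [one_pow, one_mul] at hlim
  refine le_of_tendsto hlim ?_
  filter_upwards [Ioo_mem_nhdsLT (zero_lt_one' ℝ)] with r hr using key r hr.1 hr.2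

/-- **Bohr-type majorant bound** for holomorphic functions on the unit disk with modulus
greater than one. -/
theorem sum_range_norm_le_sq_of_one_lt_norm {f : ℂ → ℂ} {a : ℕ → ℂ}
    (hrep : ∀ z : ℂ, ‖z‖ < 1 → HasSum (fun n : ℕ => a n * z ^ n) (f z))
    (hout : ∀ z : ℂ, ‖z‖ < 1 → 1 < ‖f z‖) {r : ℝ} (hr0 : 0 ≤ r) (hr : r ≤ 1 / 3) (N : ℕ) :
    ∑ n ∈ range (N + 1), ‖a n‖ * r ^ n ≤ ‖a 0‖ ^ 2 := by
  obtain ⟨hf, ha⟩ := differentiableOn_and_iteratedDeriv_of_hasSum hrep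
  have hout' : ∀ z ∈ ball (0 : ℂ) 1, 1 < ‖f z‖ := fun z hz =>
    hout z (mem_ball_zero_iff.1 hz)
  obtain ⟨g, hg, hfg⟩ := exists_differentiableOn_exp_eq one_pos hf fun z hz h0 => by
    have := hout' z hz
    simp only [h0, norm_zero] at this
    linarith
  have hre : ∀ z ∈ ball (0 : ℂ) 1, 0 ≤ (g z).re := by
    intro z hz
    have := hout' z hz
    rw [← hfg z hz, norm_exp, Real.one_lt_exp_iff] at this
    exact this.le
  have h0 : Real.exp (g 0).re = ‖a 0‖ := by
    rw [← norm_exp, hfg 0 (mem_ball_self one_pos)]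
    simpa using congrArg norm (ha 0)
  have hL := hre 0 (mem_ball_self one_pos)
  have hrec : ∀ n : ℕ, ((n : ℝ) + 1) * ‖a (n + 1)‖ ≤
      2 * (g 0).re * ∑ i ∈ range (n + 1), ((i : ℝ) + 1) * ‖a (n - i)‖ := by
    intro n
    have h := congrArg norm (iteratedDeriv_succ_of_exp_eq one_pos hf hg hfg n)
    rw [ha, norm_mul, Complex.norm_natCast, Nat.factorial_succ] at h
    have hn : (0 : ℝ) < n.factorial := by positivity
    refine le_of_mul_le_mul_left ?_ hn
    calc (n.factorial : ℝ) * (((n : ℝ) + 1) * ‖a (n + 1)‖)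
        = ((((n + 1) * n.factorial : ℕ) : ℝ)) * ‖a (n + 1)‖ := by push_cast; ring
      _ ≤ ∑ i ∈ range (n + 1), ‖(n.choose i : ℂ) * iteratedDeriv (i + 1) g 0 *
            iteratedDeriv (n - i) f 0‖ := h ▸ norm_sum_le _ _
      _ ≤ ∑ i ∈ range (n + 1), (n.factorial : ℝ) *
            (2 * (g 0).re * (((i : ℝ) + 1) * ‖a (n - i)‖)) := by
          refine sum_le_sum fun i hi => ?_
          have hc := Nat.choose_mul_factorial_mul_factorial (Nat.lt_succ_iff.1 (mem_range.1 hi))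
          rw [ha, norm_mul, norm_mul, norm_mul, Complex.norm_natCast, Complex.norm_natCast, ← hc]
          calc (n.choose i : ℝ) * ‖iteratedDeriv (i + 1) g 0‖ *
                ((n - i).factorial * ‖a (n - i)‖)
              ≤ (n.choose i : ℝ) * ((i + 1).factorial * (2 * (g 0).re)) *
                ((n - i).factorial * ‖a (n - i)‖) := by
                gcongr
                exact norm_iteratedDeriv_le_of_re_nonneg hg hre i.succ_ne_zero
            _ = _ := by
                rw [Nat.factorial_succ]; push_cast; ring
      _ = _ := by rw [← mul_sum, ← mul_sum]
  have hexp : 2 * (g 0).re * (r / (1 - r)) ≤ (g 0).re := by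
    have : r / (1 - r) ≤ 1 / 2 := by
      rw [div_le_iff₀ (by linarith)]; linarith
    nlinarith
  calc ∑ n ∈ range (N + 1), ‖a n‖ * r ^ n
      ≤ ‖a 0‖ * Real.exp (2 * (g 0).re * (r / (1 - r))) :=
        sum_range_le_mul_exp_of_recursive_le (fun n => norm_nonneg (a n)) (by positivity) hrec
          hr0 (by linarith) N
    _ ≤ ‖a 0‖ * Real.exp (g 0).re := by gcongr
    _ = ‖a 0‖ ^ 2 := by rw [h0, sq]

/-- The map `T ↦ (T - A) / √(1 + T ^ 2)` is bounded by `(A - 1) / √2` on `[A, A ^ 2]`. -/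
theorem div_sqrt_one_add_sq_le {A T : ℝ} (hA : 1 < A) (hAT : A ≤ T) (hT : T ≤ A ^ 2) :
    (T - A) / √(1 + T ^ 2) ≤ (A - 1) / √2 := by
  rw [div_le_div_iff₀ (by positivity) (by positivity)]
  refine abs_le_of_sq_le_sq' ?_ (by have := Real.sqrt_nonneg (1 + T ^ 2); nlinarith) |>.2
  rw [mul_pow, mul_pow, Real.sq_sqrt (by positivity), Real.sq_sqrt (by positivity)]
  have h1 : A * (T - A) ≤ (A - 1) * T := by nlinarith
  have h2 : T - A ≤ A * (A - 1) := by nlinarith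
  have h3 : (T - A) * (A * (T - A)) ≤ (A * (A - 1)) * ((A - 1) * T) :=
    mul_le_mul h2 h1 (by nlinarith) (by nlinarith)
  have h4 : (T - A) ^ 2 ≤ (A - 1) ^ 2 * T := by
    refine le_of_mul_le_mul_left ?_ (zero_lt_one.trans hA)
    linarith
  nlinarith [mul_nonneg (sq_nonneg (A - 1)) (sq_nonneg (T - 1))]

/-- Bohr phenomenon in the chordal metric for maps into the exterior of the
closed unit disk: if `f z = ∑ aₙ zⁿ` is analytic in the unit disk with
`|f| > 1` there, then for `|z| ≤ 1/3`,
`χ(∑ |aₙ zⁿ|, |a₀|) ≤ inf_{|w|=1} χ(a₀, w)`. -/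
theorem bohr_chordal_exterior_disk
    (f : ℂ → ℂ) (a : ℕ → ℂ)
    (hrep : ∀ z : ℂ, ‖z‖ < 1 → HasSum (fun n : ℕ => a n * z ^ n) (f z))
    (hout : ∀ z : ℂ, ‖z‖ < 1 → 1 < ‖f z‖) :
    ∀ z : ℂ, ‖z‖ ≤ 1 / 3 →
      chordal ((∑' n : ℕ, ‖a n * z ^ n‖ : ℝ) : ℂ) ((‖a 0‖ : ℝ) : ℂ) ≤
        ⨅ w : {w : ℂ // ‖w‖ = 1}, chordal (a 0) (w : ℂ) := by
  intro z hz
  have hpart : ∀ N, ∑ n ∈ range N, ‖a n * z ^ n‖ ≤ ‖a 0‖ ^ 2 := by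
    intro N
    refine (sum_le_sum_of_subset_of_nonneg (range_mono N.le_succ)
      fun _ _ _ => norm_nonneg _).trans ?_
    simpa using sum_range_norm_le_sq_of_one_lt_norm hrep hout (norm_nonneg z) hz N
  have hsum : Summable fun n => ‖a n * z ^ n‖ :=
    summable_of_sum_range_le (fun _ => norm_nonneg _) hpart
  set T := ∑' n, ‖a n * z ^ n‖ 
  have hT : T ≤ ‖a 0‖ ^ 2 := Real.tsum_le_of_sum_range_le (fun _ => norm_nonneg _) hpart
  have hAT : ‖a 0‖ ≤ T := by
    have := hsum.le_tsum 0 fun _ _ => norm_nonneg _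
    rwa [pow_zero, mul_one] at this
  have hA : 1 < ‖a 0‖ := by
    have h0 : f 0 = a 0 := by
      have h := hasSum_single (f := fun n : ℕ => a n * (0 : ℂ) ^ n) 0
        fun n hn => by simp [hn]
      simpa using (hrep 0 (by simp)).unique h
    simpa [h0] using hout 0 (by simp)
  have : Nonempty {w : ℂ // ‖w‖ = 1} := ⟨⟨1, norm_one⟩⟩
  refine le_ciInf fun w => ?_
  have hw : ‖a 0‖ - 1 ≤ ‖a 0 - w‖ := by
    simpa [w.2] using norm_sub_norm_le (a 0) (w : ℂ)
  have hl : ‖(T : ℂ) - (‖a 0‖ : ℝ)‖ = T - ‖a 0‖ := by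
    rw [← ofReal_sub, norm_real, Real.norm_of_nonneg (sub_nonneg.2 hAT)]
  unfold chordal
  rw [hl, norm_real, norm_real, norm_norm, Real.norm_of_nonneg ((norm_nonneg _).trans hAT), w.2,
    one_pow, one_add_one_eq_two, mul_comm √(1 + ‖a 0‖ ^ 2) √2, ← div_div, ← div_div]
  refine div_le_div_of_nonneg_right ?_ (Real.sqrt_nonneg _)
  exact (div_sqrt_one_add_sq_le hA hAT hT).trans (by gcongr)
end
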